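/- arXiv:2209.03325 — 2 statements merged into one kernel-verified Lean document; each statement's English description precedes it below -/
import Mathlib

section
/- There exists ε₀ > 0 such that for every real ε with 0 < ε < ε₀ there exists k₀ so that for every integer k ≥ k₀ the following holds: every Hamiltonian graph G on n ≥ (2+ε)k² vertices with independence number at most k contains a cycle of length ℓ for every integer ℓ with (2+ε)k ≤ ℓ ≤ 1000k/ε². -/
open SimpleGraph Finset

/-- `G` contains a cycle of length `ℓ`. -/
def HasCycleLength {V : Type} (G : SimpleGraph V) (ℓ : ℕ) : Prop :=
  ∃ (v : V) (c : G.Walk v v), c.IsCycle ∧ c.length = ℓ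

/-- `G` is Hamiltonian: it contains a cycle passing through all vertices. -/
def IsHamiltonianGraph {V : Type} (G : SimpleGraph V) : Prop :=
  ∃ (v : V) (c : G.Walk v v), c.IsCycle ∧ ∀ u : V, u ∈ c.support

/-- The independence number of `G` is at most `k`. -/
def IndepNumLE {V : Type} (G : SimpleGraph V) (k : ℕ) : Prop :=
  ∀ s : Finset V, (∀ x ∈ s, ∀ y ∈ s, x ≠ y → ¬ G.Adj x y) → s.card ≤ k

/-- `G` is pancyclic: it contains cycles of every length from `3` to `|V(G)|`. -/
def Pancyclic {V : Type} [Fintype V] (G : SimpleGraph V) : Prop :=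
  ∀ ℓ : ℕ, 3 ≤ ℓ → ℓ ≤ Fintype.card V → HasCycleLength G ℓ

namespace PC
open scoped Classical

/-- path of length `q` from `x` to `y` with all vertices in `X` -/
def HP {V : Type} (G : SimpleGraph V) (X : Finset V) (x y : V) (q : ℕ) : Prop :=
  ∃ p : G.Walk x y, p.IsPath ∧ (∀ v ∈ p.support, v ∈ X) ∧ p.length = q

/-- independent -/
def Ind {V : Type} (G : SimpleGraph V) (s : Finset V) : Prop :=
  ∀ x ∈ s, ∀ y ∈ s, x ≠ y → ¬ G.Adj x y

/-- connected via cuts -/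
def Conn {V : Type} (G : SimpleGraph V) (C : Finset V) : Prop :=
  ∀ A ⊆ C, A.Nonempty → A ≠ C → ∃ u ∈ A, ∃ w ∈ C, w ∉ A ∧ G.Adj u w

/-- closed neighbourhood of `A` inside `S` -/
noncomputable def NS {V : Type} (G : SimpleGraph V) (S A : Finset V) : Finset V :=
  S.filter (fun z => z ∈ A ∨ ∃ u ∈ A, G.Adj u z)

variable {V : Type} {G : SimpleGraph V}

lemma HP.refl {X : Finset V} {x : V} (h : x ∈ X) : HP G X x x 0 :=
  ⟨Walk.nil, by simp, by simpa using h, rfl⟩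

lemma HP.mono {X Y : Finset V} {x y : V} {q : ℕ} (h : HP G X x y q) (hs : X ⊆ Y) : HP G Y x y q := by
  obtain ⟨p, h1, h2, h3⟩ := h
  exact ⟨p, h1, fun v hv => hs (h2 v hv), h3⟩

lemma HP.symm {X : Finset V} {x y : V} {q : ℕ} (h : HP G X x y q) : HP G X y x q := by
  obtain ⟨p, h1, h2, h3⟩ := h
  exact ⟨p.reverse, h1.reverse, fun v hv => h2 v (by simpa using hv), by simpa using h3⟩

lemma HP.cons {B : Finset V} {x y w : V} {r : ℕ} (hxy : G.Adj x y) (h : HP G B y w r) (hx : x ∉ B) :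
    HP G (insert x B) x w (r+1) := by
  obtain ⟨p, h1, h2, h3⟩ := h
  refine ⟨Walk.cons hxy p, ?_, ?_, by simp [h3]⟩
  · rw [Walk.cons_isPath_iff]
    exact ⟨h1, fun h => hx (h2 _ h)⟩
  · intro v hv
    simp only [Walk.support_cons, List.mem_cons] at hv
    rcases hv with rfl | hv
    · simp
    · exact mem_insert_of_mem (h2 v hv)

lemma HP.join {A B : Finset V} {x u w : V} {q r : ℕ} (h : HP G A x u q) (h' : HP G B u w r)
    (hd : ∀ v ∈ A, v ∈ B → v = u) : HP G (A ∪ B) x w (q + r) := by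
  obtain ⟨p, h1, h2, h3⟩ := h
  obtain ⟨p', h1', h2', h3'⟩ := h'
  refine ⟨p.append p', ?_, ?_, by simp [h3, h3']⟩
  · rw [Walk.isPath_def, Walk.support_append, List.nodup_append']
    refine ⟨h1.support_nodup, h1'.support_nodup.tail, ?_⟩
    intro v hv hv'
    have := hd v (h2 v hv) (h2' v (List.mem_of_mem_tail hv'))
    subst this
    have hn := h1'.support_nodup
    rw [Walk.support_eq_cons] at hn
    exact (List.nodup_cons.mp hn).1 hv'
  · intro v hv
    rw [Walk.mem_support_append_iff] at hv
    rcases hv with hv | hv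
    · exact mem_union_left _ (h2 v hv)
    · exact mem_union_right _ (h2' v hv)

lemma HP.mem_left {A : Finset V} {x u : V} {q : ℕ} (h : HP G A x u q) : x ∈ A := by
  obtain ⟨p, h1, h2, h3⟩ := h
  exact h2 _ (by simp)

lemma HP.mem_right {A : Finset V} {x u : V} {q : ℕ} (h : HP G A x u q) : u ∈ A := by
  obtain ⟨p, h1, h2, h3⟩ := h
  exact h2 _ (by simp)

lemma HP.joinE {A B : Finset V} {x u v w : V} {q r : ℕ} (h : HP G A x u q) (huv : G.Adj u v)
    (h' : HP G B v w r) (hd : Disjoint A B) : HP G (A ∪ B) x w (q + r + 1) := by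
  have hu := h.mem_right
  have h1 := HP.cons huv h' (Finset.disjoint_left.mp hd hu)
  have := h.join h1 (by
    intro z hz hz'
    rcases mem_insert.mp hz' with h | h
    · exact h
    · exact absurd h (Finset.disjoint_left.mp hd hz))
  rw [add_assoc]
  refine this.mono ?_
  intro z hz
  simp only [mem_union, mem_insert] at hz ⊢
  rcases hz with h | rfl | h
  · exact Or.inl h
  · exact Or.inl hu
  · exact Or.inr h

lemma HP.cycle {X : Finset V} {x y : V} {q : ℕ} (h : HP G X x y q) (hq : 2 ≤ q) (ha : G.Adj y x) :
    HasCycleLength G (q+1) := by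
  obtain ⟨p, h1, h2, h3⟩ := h
  refine ⟨y, Walk.cons ha p, ?_, by simp [h3]⟩
  rw [Walk.cons_isCycle_iff]
  refine ⟨h1, ?_⟩
  intro he
  have : p.length = 1 := by
    apply h1.length_eq_one_of_mem_edges
    rwa [Sym2.eq_swap]
  omega

lemma HP.card_le {X : Finset V} {x y : V} {q : ℕ} (h : HP G X x y q) : q + 1 ≤ X.card := by
  obtain ⟨p, h1, h2, h3⟩ := h
  have : p.support.toFinset.card = q + 1 := by
    rw [List.toFinset_card_of_nodup h1.support_nodup]; simp [h3]
  rw [← this]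
  exact card_le_card (fun v hv => h2 v (by simpa using hv))

lemma HP.of_seq {X : Finset V} (w : ℕ → V) (i q : ℕ)
    (hadj : ∀ m, i ≤ m → m < i + q → G.Adj (w m) (w (m+1)))
    (hinj : ∀ m m', i ≤ m → m < m' → m' ≤ i + q → w m ≠ w m')
    (hX : ∀ m, i ≤ m → m ≤ i + q → w m ∈ X) : HP G X (w i) (w (i+q)) q := by
  induction q generalizing i X with
  | zero => exact HP.refl (hX i le_rfl (by omega))
  | succ q ih =>
    have h := ih (X := X.erase (w i)) (i+1) (fun m h1 h2 => hadj m (by omega) (by omega))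
      (fun m m' h1 h2 h3 => hinj m m' (by omega) h2 (by omega))
      (fun m h1 h2 => mem_erase.mpr ⟨(hinj i m le_rfl (by omega) (by omega)).symm,
        hX m (by omega) (by omega)⟩)
    have h2 := HP.cons (hadj i le_rfl (by omega)) h (by simp)
    rw [Finset.insert_erase (hX i le_rfl (by omega))] at h2
    have e : i + 1 + q = i + (q + 1) := by omega
    rwa [e] at h2

lemma HP.to_seq {X : Finset V} {x y : V} {q : ℕ} (h : HP G X x y q) :
    ∃ w : ℕ → V, w 0 = x ∧ w q = y ∧ (∀ m, m < q → G.Adj (w m) (w (m+1))) ∧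
      (∀ m m', m < m' → m' ≤ q → w m ≠ w m') ∧ (∀ m, m ≤ q → w m ∈ X) := by
  obtain ⟨p, h1, h2, h3⟩ := h
  subst h3
  refine ⟨p.getVert, by simp, by simp, fun m hm => p.adj_getVert_succ hm, ?_, ?_⟩
  · intro m m' hm hm' he
    have := h1.getVert_injOn (show m ∈ {i | i ≤ p.length} by simp; omega)
      (show m' ∈ {i | i ≤ p.length} from hm') he
    omega
  · intro m _
    exact h2 _ (Walk.getVert_mem_support _ _)

/-- prefixes -/
lemma HP.prefixes {X : Finset V} {x y : V} {q : ℕ} (h : HP G X x y q) :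
    ∃ X' ⊆ X, x ∈ X' ∧ X'.card ≤ q + 1 ∧ ∀ i ≤ q, ∃ z, HP G X' x z i := by
  obtain ⟨w, h0, h1, h2, h3, h4⟩ := h.to_seq
  refine ⟨(range (q+1)).image w, ?_, ?_, ?_, ?_⟩
  · intro z hz
    simp only [mem_image, mem_range] at hz
    obtain ⟨m, hm, rfl⟩ := hz
    exact h4 m (by omega)
  · rw [← h0]; exact mem_image_of_mem _ (by simp)
  · exact card_image_le.trans (by simp)
  · intro i hi
    refine ⟨w (0+i), ?_⟩
    rw [← h0]
    exact HP.of_seq w 0 i (fun m _ hm => h2 m (by omega)) (fun m m' _ a b => h3 m m' a (by omega))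
      (fun m _ hm => mem_image_of_mem _ (by simp; omega))

/-- shortcut -/
lemma HP.short {X : Finset V} {x y : V} {q k : ℕ} (hk : IndepNumLE G k) (h : HP G X x y q)
    (hq : 2 * k ≤ q) : ∃ q', q < q' + 2 * k ∧ q' < q ∧ HP G X x y q' := by
  obtain ⟨w, h0, h1, h2, h3, h4⟩ := h.to_seq
  have hex : ∃ i j, i < j ∧ j ≤ k ∧ G.Adj (w (2*i)) (w (2*j)) := by
    by_contra hcon
    push Not at hcon
    have := hk ((range (k+1)).image (fun i => w (2*i))) (by
      intro a ha b hb hab hadj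
      simp only [mem_image, mem_range] at ha hb
      obtain ⟨i, hi, rfl⟩ := ha
      obtain ⟨j, hj, rfl⟩ := hb
      rcases lt_trichotomy i j with h | h | h
      · exact hcon i j h (by omega) hadj
      · subst h; exact hab rfl
      · exact hcon j i h (by omega) hadj.symm)
    rw [card_image_of_injOn] at this
    · simp at this
    · intro i hi j hj hij
      simp only [coe_range, Set.mem_Iio] at hi hj
      by_contra hne
      rcases lt_or_gt_of_ne hne with h | h
      · exact h3 (2*i) (2*j) (by omega) (by omega) hij
      · exact h3 (2*j) (2*i) (by omega) (by omega) hij.symm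
  obtain ⟨i, j, hij, hj, hadj⟩ := hex
  have p1 : HP G ((range (2*i+1)).image w) (w 0) (w (0+2*i)) (2*i) :=
    HP.of_seq w 0 (2*i) (fun m _ hm => h2 m (by omega)) (fun m m' _ a b => h3 m m' a (by omega))
      (fun m _ hm => mem_image_of_mem _ (by simp; omega))
  have p2 : HP G ((Icc (2*j) q).image w) (w (2*j)) (w (2*j+(q-2*j))) (q-2*j) :=
    HP.of_seq w (2*j) (q-2*j) (fun m _ hm => h2 m (by omega)) (fun m m' _ a b => h3 m m' a (by omega))
      (fun m _ hm => mem_image_of_mem _ (by simp; omega))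
  rw [zero_add] at p1
  have p3 := p1.joinE hadj p2 (by
    rw [Finset.disjoint_left]
    intro z hz hz'
    simp only [mem_image, mem_range, mem_Icc] at hz hz'
    obtain ⟨m, hm, rfl⟩ := hz
    obtain ⟨m', hm', he⟩ := hz'
    exact h3 m m' (by omega) (by omega) he.symm)
  have e : 2*j+(q-2*j) = q := by omega
  rw [e, h0, h1] at p3
  refine ⟨_, ?_, ?_, p3.mono ?_⟩
  · omega
  · omega
  · intro z hz
    simp only [mem_union, mem_image, mem_range, mem_Icc] at hz
    rcases hz with ⟨m, hm, rfl⟩ | ⟨m, hm, rfl⟩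
    · exact h4 m (by omega)
    · exact h4 m (by omega)

lemma HP.window {X : Finset V} {x y : V} {k : ℕ} (hk : IndepNumLE G k) (τ : ℕ) (hτ : 2 * k ≤ τ)
    (q : ℕ) (h : HP G X x y q) (hq : τ ≤ q) :
    ∃ q', τ ≤ q' + 2 * k ∧ q' ≤ τ ∧ HP G X x y q' := by
  induction q using Nat.strong_induction_on with
  | _ q ih =>
    rcases hq.eq_or_lt with rfl | hlt
    · exact ⟨τ, by omega, le_rfl, h⟩
    · obtain ⟨q', h1, h2, h3⟩ := h.short hk (by omega)
      by_cases hc : τ ≤ q'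
      · exact ih q' h2 h3 hc
      · exact ⟨q', by omega, by omega, h3⟩

lemma HP.of_walk {X : Finset V} {x y : V} (p : G.Walk x y) (h : ∀ v ∈ p.support, v ∈ X) :
    ∃ q ≤ p.length, HP G X x y q :=
  ⟨p.bypass.length, Walk.length_bypass_le_length p, p.bypass, Walk.bypass_isPath p,
    fun v hv => h v (Walk.support_bypass_subset_support p hv), rfl⟩

lemma Conn.path {C : Finset V} (hC : Conn G C) {x y : V} (hx : x ∈ C) (hy : y ∈ C) :
    ∃ q, q + 1 ≤ C.card ∧ HP G C x y q := by
  let A := C.filter (fun z => ∃ p : G.Walk x z, ∀ v ∈ p.support, v ∈ C)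
  have hA : A = C := by
    by_contra hne
    obtain ⟨u, hu, w, hw, hwA, huw⟩ := hC A (filter_subset _ _)
      ⟨x, by simp only [A, mem_filter]; exact ⟨hx, Walk.nil, by simpa using hx⟩⟩ hne
    apply hwA
    simp only [A, mem_filter] at hu ⊢
    obtain ⟨huC, p, hp⟩ := hu
    refine ⟨hw, p.concat huw, ?_⟩
    intro v hv
    simp only [Walk.support_concat, List.concat_eq_append, List.mem_append, List.mem_singleton] at hv
    rcases hv with hv | rfl
    · exact hp v hv
    · exact hw
  rw [← hA] at hy
  simp only [A, mem_filter] at hy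
  obtain ⟨_, p, hp⟩ := hy
  obtain ⟨q, _, hq⟩ := HP.of_walk p hp
  exact ⟨q, hq.card_le, hq⟩

/-- greedy path -/
lemma greedy {A : Finset V} {r : ℕ} (hA : ∀ v ∈ A, r ≤ (A.filter (fun u => G.Adj v u)).card)
    {x : V} (hx : x ∈ A) : ∀ i ≤ r, ∃ y, HP G A x y i := by
  suffices H : ∀ i ≤ r, ∃ y, ∃ X ⊆ A, X.card ≤ i + 1 ∧ HP G X y x i by
    intro i hi
    obtain ⟨y, X, hX, _, h⟩ := H i hi
    exact ⟨y, (h.mono hX).symm⟩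
  intro i
  induction i with
  | zero => intro _; exact ⟨x, {x}, by simpa using hx, by simp, HP.refl (by simp)⟩
  | succ i ih =>
    intro hi
    obtain ⟨y, X, hX, hc, h⟩ := ih (by omega)
    have hy := hX h.mem_left
    have : ∃ z ∈ A.filter (fun u => G.Adj y u), z ∉ X.erase y := by
      by_contra hcon
      push Not at hcon
      have h1 := card_le_card (fun z hz => hcon z hz)
      rw [card_erase_of_mem h.mem_left] at h1
      have := hA y hy
      omega
    obtain ⟨z, hz, hzX⟩ := this
    simp only [mem_filter] at hz
    have hzX' : z ∉ X := fun hh => hzX (mem_erase.mpr ⟨hz.2.ne', hh⟩)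
    refine ⟨z, insert z X, ?_, ?_, HP.cons hz.2.symm h hzX'⟩
    · intro v hv
      rcases mem_insert.mp hv with rfl | hv
      · exact hz.1
      · exact hX hv
    · exact (card_insert_le _ _).trans (by omega)

/-- dense subset -/
lemma dense_sub {A : Finset V} {r a : ℕ} (ha : ∀ I ⊆ A, Ind G I → I.card ≤ a) (hA : r * a < A.card) :
    ∃ B ⊆ A, B.Nonempty ∧ ∀ v ∈ B, r ≤ (B.filter (fun u => G.Adj v u)).card := by
  induction a generalizing A with
  | zero =>
    have hne : A.Nonempty := card_pos.mp (by omega)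
    obtain ⟨v, hv⟩ := hne
    have := ha {v} (by simpa using hv) (by intro x hx y hy; simp at hx hy; simp [hx, hy])
    simp at this
  | succ a ih =>
    by_cases hcase : ∀ v ∈ A, r ≤ (A.filter (fun u => G.Adj v u)).card
    · exact ⟨A, subset_rfl, card_pos.mp (by omega), hcase⟩
    · push Not at hcase
      obtain ⟨v, hv, hlt⟩ := hcase
      let A' := A.filter (fun u => u ≠ v ∧ ¬ G.Adj v u)
      have hsub : A ⊆ A' ∪ insert v (A.filter (fun u => G.Adj v u)) := by
        intro z hz
        simp only [A', mem_union, mem_filter, mem_insert]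
        tauto
      have h1 := card_le_card hsub
      have h2 := card_union_le A' (insert v (A.filter (fun u => G.Adj v u)))
      have h3 := card_insert_le v (A.filter (fun u => G.Adj v u))
      have : r * (a+1) = r * a + r := by ring
      obtain ⟨B, hB, hB'⟩ := ih (A := A') (by
        intro I hI hInd
        have := ha (insert v I) (by
          intro z hz
          rcases mem_insert.mp hz with rfl | hz
          · exact hv
          · exact (mem_filter.mp (hI hz)).1) (by
          intro x hx y hy hxy
          rcases mem_insert.mp hx with hx' | hx' <;> rcases mem_insert.mp hy with hy' | hy'
          · exact absurd (hx'.trans hy'.symm) hxy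
          · rw [hx']; exact (mem_filter.mp (hI hy')).2.2
          · rw [hy']; exact fun h => (mem_filter.mp (hI hx')).2.2 h.symm
          · exact hInd x hx' y hy' hxy)
        rw [card_insert_of_notMem (fun h => (mem_filter.mp (hI h)).2.1 rfl)] at this
        omega) (by omega)
      exact ⟨B, hB.trans (filter_subset _ _), hB'⟩

/-- A set with more than `r * a` vertices contains a short path with all prefixes. -/
lemma fine_path {A : Finset V} {r a : ℕ} (ha : ∀ I ⊆ A, Ind G I → I.card ≤ a) (hA : r * a < A.card) :
    ∃ x, ∃ X ⊆ A, x ∈ X ∧ X.card ≤ r + 1 ∧ ∀ i ≤ r, ∃ z, HP G X x z i := by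
  obtain ⟨B, hB, ⟨x, hx⟩, hdeg⟩ := dense_sub ha hA
  obtain ⟨y, hy⟩ := greedy hdeg hx r le_rfl
  obtain ⟨X, h1, h2, h3, h4⟩ := hy.prefixes
  exact ⟨x, X, h1.trans hB, h2, h3, h4⟩

/-- connected set growth -/
lemma grow_set {H : Finset V} (hH : Conn G H) {x : V} (hx : x ∈ H) (j : ℕ) :
    ∃ Y ⊆ H, x ∈ Y ∧ Conn G Y ∧ Y.card ≤ 2 * (j + 1) ∧ ∃ I ⊆ Y, Ind G I ∧
      (I.card = j + 1 ∨ ∀ z ∈ H, z ∈ I ∨ ∃ u ∈ I, G.Adj u z) := by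
  suffices Hs : ∃ Y ⊆ H, x ∈ Y ∧ Conn G Y ∧ Y.card ≤ 2 * (j + 1) ∧ ∃ I ⊆ Y, Ind G I ∧ I.Nonempty ∧
      (I.card = j + 1 ∨ ∀ z ∈ H, z ∈ I ∨ ∃ u ∈ I, G.Adj u z) by
    obtain ⟨Y, h1, h2, h3, h4, I, h5, h6, _, h7⟩ := Hs
    exact ⟨Y, h1, h2, h3, h4, I, h5, h6, h7⟩
  induction j with
  | zero =>
    refine ⟨{x}, by simpa using hx, by simp, ?_, by simp, {x}, subset_rfl, ?_, by simp, Or.inl (by simp)⟩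
    · intro A hA hne hneq
      exfalso
      rcases Finset.subset_singleton_iff.mp hA with h | h
      · simp [h] at hne
      · exact hneq h
    · intro a ha b hb; simp at ha hb; simp [ha, hb]
  | succ j ih =>
    obtain ⟨Y, hY, hxY, hYc, hcard, I, hI, hInd, hIne, hor⟩ := ih
    by_cases hdom : ∀ z ∈ H, z ∈ I ∨ ∃ u ∈ I, G.Adj u z
    · exact ⟨Y, hY, hxY, hYc, by omega, I, hI, hInd, hIne, Or.inr hdom⟩
    have hIc : I.card = j + 1 := by
      rcases hor with h | h
      · exact h
      · exact absurd h hdom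
    have hN : NS G H I ≠ H := by
      intro he
      apply hdom
      intro z hz
      rw [← he] at hz
      exact (mem_filter.mp hz).2
    obtain ⟨i0, hi0⟩ := hIne
    obtain ⟨u, hu, w, hw, hwn, huw⟩ := hH (NS G H I) (filter_subset _ _)
      ⟨i0, mem_filter.mpr ⟨hY (hI hi0), Or.inl hi0⟩⟩ hN
    have hwn' : w ∉ I ∧ ∀ v ∈ I, ¬ G.Adj v w := by
      constructor
      · intro h; exact hwn (mem_filter.mpr ⟨hw, Or.inl h⟩)
      · intro v hv h; exact hwn (mem_filter.mpr ⟨hw, Or.inr ⟨v, hv, h⟩⟩)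
    have hu' := mem_filter.mp hu
    have huI : u ∉ I := fun h => hwn'.2 u h huw
    obtain ⟨v, hvI, hvu⟩ : ∃ v ∈ I, G.Adj v u := by
      rcases hu'.2 with h | h
      · exact absurd h huI
      · exact h
    have hins : ∀ {Z : Finset V} {a b : V}, Conn G Z → a ∈ Z → G.Adj a b → Conn G (insert b Z) := by
      intro Z a b hZ ha hab A hA hne hneq
      by_cases hAZ : Z ⊆ A
      · have hb : b ∉ A := by
          intro hb
          apply hneq
          apply subset_antisymm hA
          intro z hz
          rcases mem_insert.mp hz with rfl | h
          · exact hb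
          · exact hAZ h
        exact ⟨a, hAZ ha, b, by simp, hb, hab⟩
      · by_cases hAn : (A ∩ Z).Nonempty
        · obtain ⟨p, hp, q, hq, hqn, hpq⟩ := hZ (A ∩ Z) inter_subset_right hAn (by
            intro h; apply hAZ; rw [← h]; exact inter_subset_left)
          refine ⟨p, (mem_inter.mp hp).1, q, mem_insert_of_mem hq, ?_, hpq⟩
          intro h; exact hqn (mem_inter.mpr ⟨h, hq⟩)
        · have haA : a ∉ A := fun h => hAn ⟨a, mem_inter.mpr ⟨h, ha⟩⟩
          obtain ⟨z, hz⟩ := hne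
          have : z = b := by
            rcases mem_insert.mp (hA hz) with h | h
            · exact h
            · exact absurd ⟨z, mem_inter.mpr ⟨hz, h⟩⟩ hAn
          subst this
          exact ⟨z, hz, a, mem_insert_of_mem ha, haA, hab.symm⟩
    refine ⟨insert w (insert u Y), ?_, ?_, ?_, ?_, insert w I, ?_, ?_, by simp, ?_⟩
    · intro z hz
      simp only [mem_insert] at hz
      rcases hz with rfl | rfl | h
      · exact hw
      · exact hu'.1
      · exact hY h
    · simp [hxY]
    · exact hins (hins hYc (hI hvI) hvu) (mem_insert_self _ _) huw
    · have h1 := card_insert_le w (insert u Y)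
      have h2 := card_insert_le u Y
      omega
    · intro z hz
      simp only [mem_insert] at hz ⊢
      rcases hz with rfl | h
      · simp
      · exact Or.inr (Or.inr (hI h))
    · intro a ha b hb hab
      rcases mem_insert.mp ha with ha' | ha' <;> rcases mem_insert.mp hb with hb' | hb'
      · exact absurd (ha'.trans hb'.symm) hab
      · rw [ha']; exact fun h => hwn'.2 b hb' h.symm
      · rw [hb']; exact hwn'.2 a ha'
      · exact hInd a ha' b hb' hab
    · left
      rw [card_insert_of_notMem hwn'.1, hIc]

end PC

namespace PC
open scoped Classical
variable {V : Type} {G : SimpleGraph V}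

/-- The extracted structural facts. -/
structure Good (G : SimpleGraph V) (S : Finset V) (a k d Λ : ℕ) : Prop where
  a1 : 1 ≤ a
  ak : a ≤ k
  ind : ∀ I ⊆ S, Ind G I → I.card ≤ a
  lo : 2 * k * a ≤ S.card
  hi : S.card ≤ 4 * k * a
  nbr : ∀ I ⊆ S, Ind G I → 2 * k * I.card ≤ (NS G S I).card
  deg : ∀ v ∈ S, 2 * k + 3 * d ≤ (NS G S {v}).card
  cut : ∀ A B F : Finset V, A ⊆ S → B ⊆ S → S ⊆ A ∪ B ∪ F → Disjoint A B → A.Nonempty → B.Nonempty →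
    (∀ x ∈ A, ∀ y ∈ B, ¬ G.Adj x y) → d < F.card ∧ min A.card B.card ≤ Λ * F.card

/-- independence number of a set -/
noncomputable def al (G : SimpleGraph V) (A : Finset V) : ℕ :=
  (A.powerset.filter (fun I => Ind G I)).sup card

lemma le_al {A I : Finset V} (hI : I ⊆ A) (h : Ind G I) : I.card ≤ al G A :=
  Finset.le_sup (f := card) (by simp [hI, h])

lemma al_wit (A : Finset V) : ∃ I ⊆ A, Ind G I ∧ I.card = al G A := by
  have hne : (A.powerset.filter (fun I => Ind G I)).Nonempty := ⟨∅, by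
    rw [mem_filter]; exact ⟨by simp, by intro x hx; simp at hx⟩⟩
  obtain ⟨I, hI, h⟩ := Finset.exists_mem_eq_sup _ hne card
  simp only [mem_filter, mem_powerset] at hI
  exact ⟨I, hI.1, hI.2, h.symm⟩

lemma al_pos {A : Finset V} (h : A.Nonempty) : 1 ≤ al G A := by
  obtain ⟨v, hv⟩ := h
  have := le_al (G := G) (A := A) (I := {v}) (by simpa using hv) (by
    intro x hx y hy; simp at hx hy; simp [hx, hy])
  simpa using this

lemma al_mono {A B : Finset V} (h : A ⊆ B) : al G A ≤ al G B := by
  obtain ⟨I, h1, h2, h3⟩ := al_wit (G := G) A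
  rw [← h3]; exact le_al (h1.trans h) h2

lemma al_add {A B S : Finset V} (hA : A ⊆ S) (hB : B ⊆ S) (hd : Disjoint A B)
    (hn : ∀ x ∈ A, ∀ y ∈ B, ¬ G.Adj x y) : al G A + al G B ≤ al G S := by
  obtain ⟨I, h1, h2, h3⟩ := al_wit (G := G) A
  obtain ⟨J, h1', h2', h3'⟩ := al_wit (G := G) B
  rw [← h3, ← h3', ← card_union_of_disjoint (disjoint_of_subset_left h1 (disjoint_of_subset_right h1' hd))]
  apply le_al (union_subset (h1.trans hA) (h1'.trans hB))
  intro x hx y hy hxy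
  rcases mem_union.mp hx with hx | hx <;> rcases mem_union.mp hy with hy | hy
  · exact h2 x hx y hy hxy
  · exact hn x (h1 hx) y (h1' hy)
  · exact fun h => hn y (h1 hy) x (h1' hx) h.symm
  · exact h2' x hx y hy hxy

/-- weight function -/
noncomputable def ff (b g δ : ℝ) (x : ℕ) : ℝ := b * x + g * (x * (Nat.log 2 x : ℕ)) - δ

lemma ff_diff {b g δ : ℝ} (hg : 0 ≤ g) {x y : ℕ} (h : x ≤ y) :
    ff b g δ x + b * ((y:ℝ) - x) ≤ ff b g δ y := by
  unfold ff
  have h1 : ((x:ℝ) * (Nat.log 2 x : ℕ)) ≤ (y:ℝ) * (Nat.log 2 y : ℕ) := by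
    have : Nat.log 2 x ≤ Nat.log 2 y := Nat.log_mono_right h
    exact_mod_cast Nat.mul_le_mul h this
  nlinarith [mul_le_mul_of_nonneg_left h1 hg]

lemma ff_super1 {b g δ : ℝ} (hg : 0 ≤ g) {x y : ℕ} (hx : 1 ≤ x) (h : x ≤ y) :
    ff b g δ x + ff b g δ y + δ + g * x ≤ ff b g δ (x + y) := by
  unfold ff
  have h1 : Nat.log 2 x + 1 ≤ Nat.log 2 (x+y) := by
    have : Nat.log 2 (x * 2) = Nat.log 2 x + 1 := Nat.log_mul_base (by norm_num) (by omega)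
    rw [← this]; exact Nat.log_mono_right (by omega)
  have h2 : Nat.log 2 y ≤ Nat.log 2 (x+y) := Nat.log_mono_right (by omega)
  have h3 : x * Nat.log 2 x + x + y * Nat.log 2 y ≤ (x+y) * Nat.log 2 (x+y) := by nlinarith
  have h4 : (x:ℝ) * (Nat.log 2 x : ℕ) + x + y * (Nat.log 2 y : ℕ) ≤ (x+y) * (Nat.log 2 (x+y) : ℕ) := by
    exact_mod_cast h3
  have := mul_le_mul_of_nonneg_left h4 hg
  push_cast
  nlinarith

lemma ff_super {b g δ : ℝ} (hg : 0 ≤ g) {x y : ℕ} (hx : 1 ≤ x) (hy : 1 ≤ y) :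
    ff b g δ x + ff b g δ y + δ + g * (min x y : ℕ) ≤ ff b g δ (x + y) := by
  rcases le_total x y with h | h
  · rw [min_eq_left h]; exact ff_super1 hg hx h
  · rw [min_eq_right h, add_comm x y]; linarith [ff_super1 (b := b) (δ := δ) hg hy h]

lemma extract [Fintype V] {k : ℕ} {ε : ℝ} (he : 0 < ε) (he1 : ε < 1) (hk : 2 ≤ k) (hI : IndepNumLE G k)
    (hn : (2 + ε) * (k : ℝ) ^ 2 ≤ (Fintype.card V : ℝ)) (d Λ : ℕ) (hd : (d:ℝ) ≤ ε * k / 8)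
    (hΛ : 8 * (Nat.log 2 k : ℕ) / ε ≤ (Λ:ℝ)) :
    ∃ S a, Good G S a k d Λ := by
  set L := Nat.log 2 k with hL
  have hL1 : 1 ≤ L := Nat.log_pos (by norm_num) hk
  have hLr : (1:ℝ) ≤ L := by exact_mod_cast hL1
  have hkr : (2:ℝ) ≤ k := by exact_mod_cast hk
  set b : ℝ := (2 + ε/2) * k with hb
  set g : ℝ := ε * k / (2 * L) with hg
  set δ : ℝ := ε * k / 8 with hδ
  have hg0 : 0 ≤ g := by positivity
  have hδ0 : 0 < δ := by positivity
  have hgL : g * L = ε * k / 2 := by rw [hg]; field_simp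
  have halk : ∀ A : Finset V, al G A ≤ k := by
    intro A
    obtain ⟨I, h1, h2, h3⟩ := al_wit (G := G) A
    rw [← h3]; exact hI I h2
  have fub : ∀ x : ℕ, x ≤ k → ff b g δ x ≤ 3 * k * x - δ := by
    intro x hx
    unfold ff
    have h1 : ((Nat.log 2 x : ℕ) : ℝ) ≤ L := by exact_mod_cast Nat.log_mono_right hx
    have h2 : g * (x * (Nat.log 2 x : ℕ)) ≤ g * (x * L) := by gcongr
    have h3 : g * (x * L) = ε * k / 2 * x := by rw [← hgL]; ring
    have : 0 ≤ (k:ℝ) * x := by positivity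
    rw [hb]; nlinarith
  have fk : ff b g δ k ≤ (2 + ε) * (k : ℝ) ^ 2 := by
    unfold ff
    have h3 : g * (k * L) = ε * k / 2 * k := by rw [← hgL]; ring
    rw [← hL, h3, hb]; nlinarith
  have f1 : ∀ x : ℕ, 1 ≤ x → b * x - δ ≤ ff b g δ x := by
    intro x hx
    unfold ff
    have : 0 ≤ g * (x * (Nat.log 2 x : ℕ)) := by positivity
    linarith
  have fmono : ∀ x y : ℕ, x ≤ y → ff b g δ x ≤ ff b g δ y := by
    intro x y h
    have := ff_diff (b := b) (δ := δ) hg0 h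
    have hxy : (x:ℝ) ≤ y := by exact_mod_cast h
    have : 0 ≤ b * ((y:ℝ) - x) := mul_nonneg (by positivity) (by linarith)
    linarith
  let P := (univ : Finset (Finset V)).filter (fun A => A.Nonempty ∧ ff b g δ (al G A) ≤ A.card)
  have hPne : P.Nonempty := by
    refine ⟨univ, ?_⟩
    simp only [P, mem_filter, mem_univ, true_and, card_univ]
    refine ⟨?_, (fmono _ _ (halk _)).trans (fk.trans hn)⟩
    rw [← card_pos, card_univ]
    have : (0:ℝ) < Fintype.card V := lt_of_lt_of_le (by positivity) hn
    exact_mod_cast this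
  obtain ⟨S, hS, hmin⟩ := P.exists_min_image card hPne
  simp only [P, mem_filter, mem_univ, true_and] at hS hmin
  obtain ⟨hSne, hSf⟩ := hS
  have hlt : ∀ A ⊆ S, A.Nonempty → A ≠ S → (A.card:ℝ) < ff b g δ (al G A) := by
    intro A hA hAne hne
    by_contra h
    push Not at h
    have h1 := hmin A ⟨hAne, h⟩
    exact hne (eq_of_subset_of_card_le hA h1)
  have ha1 : 1 ≤ al G S := al_pos hSne
  have hhi' : ∀ A ⊆ S, (A.card : ℝ) ≤ 3 * k * al G A + 1 := by
    intro A hA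
    by_cases hAne : A.Nonempty
    · by_cases hAS : A = S
      · obtain ⟨v, hv⟩ := hSne
        by_cases h1 : (S.erase v).Nonempty
        · have h2 := hlt _ (erase_subset v S) h1 (by
            intro h; rw [← h] at hv; simp at hv)
          have h3 := fub _ (halk (S.erase v))
          have h4 : (al G (S.erase v) : ℝ) ≤ al G S := by exact_mod_cast al_mono (erase_subset v S)
          have h5 : ((S.erase v).card : ℝ) + 1 = S.card := by exact_mod_cast card_erase_add_one hv
          rw [hAS]
          have : 3 * (k:ℝ) * al G (S.erase v) ≤ 3 * k * al G S := by gcongr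
          linarith
        · rw [not_nonempty_iff_eq_empty] at h1
          have : S.card = 1 := by
            have := card_erase_add_one hv
            rw [h1] at this; simpa using this.symm
          rw [hAS, this]
          push_cast
          have : (0:ℝ) ≤ 3 * k * al G S := by positivity
          linarith
      · have h2 := hlt _ hA hAne hAS
        have h3 := fub _ (halk A)
        linarith
    · rw [not_nonempty_iff_eq_empty] at hAne
      rw [hAne]; simp; positivity
  have hhi : ∀ A ⊆ S, A.card ≤ 4 * k * al G A := by
    intro A hA
    by_cases hAne : A.Nonempty
    · have h1 := hhi' A hA
      have h2 := al_pos (G := G) hAne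
      have h3 : A.card ≤ 3 * k * al G A + 1 := by exact_mod_cast h1
      nlinarith
    · rw [not_nonempty_iff_eq_empty] at hAne
      rw [hAne]; simp
  have hlob : b * al G S - δ ≤ S.card := (f1 _ ha1).trans hSf
  have hnbr : ∀ I ⊆ S, Ind G I → I.Nonempty → b * I.card - δ ≤ (NS G S I).card := by
    intro I hIS hInd hIne
    have hIN : I ⊆ NS G S I := by
      intro z hz; simp [NS, hIS hz, hz]
    have hNS : NS G S I ⊆ S := filter_subset _ _
    have hIa : (I.card : ℝ) ≤ al G S := by exact_mod_cast le_al hIS hInd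
    have hb0 : 0 ≤ b := by positivity
    by_cases hR : (S \ NS G S I).Nonempty
    · have h1 := hlt _ sdiff_subset hR (by
        intro h
        obtain ⟨v, hv⟩ := hIne
        have : v ∈ S \ NS G S I := by rw [h]; exact hIS hv
        exact (mem_sdiff.mp this).2 (hIN hv))
      have h2 : al G (S \ NS G S I) + al G I ≤ al G S := al_add sdiff_subset hIS
        (disjoint_of_subset_right hIN sdiff_disjoint) (by
          intro x hx y hy h
          rw [mem_sdiff] at hx
          exact hx.2 (by simp only [NS, mem_filter]; exact ⟨hx.1, Or.inr ⟨y, hy, h.symm⟩⟩))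
      have h3 := le_al (G := G) (subset_refl I) hInd
      have h4 := ff_diff (b := b) (δ := δ) hg0 (show al G (S \ NS G S I) ≤ al G S by omega)
      have h5 : ((S \ NS G S I).card : ℝ) + (NS G S I).card = S.card := by
        exact_mod_cast card_sdiff_add_card_eq_card hNS
      have h6 : (I.card : ℝ) ≤ al G S - al G (S \ NS G S I) := by
        have : I.card + al G (S \ NS G S I) ≤ al G S := by omega
        have : (I.card : ℝ) + al G (S \ NS G S I) ≤ al G S := by exact_mod_cast this
        linarith
      have := mul_le_mul_of_nonneg_left h6 hb0
      linarith
    · rw [not_nonempty_iff_eq_empty, sdiff_eq_empty_iff_subset] at hR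
      have : NS G S I = S := subset_antisymm hNS hR
      rw [this]
      have := mul_le_mul_of_nonneg_left hIa hb0
      linarith
  refine ⟨S, al G S, ha1, halk S, fun I h1 h2 => le_al h1 h2, ?_, hhi S subset_rfl, ?_, ?_, ?_⟩
  · have ha1r : (1:ℝ) ≤ al G S := by exact_mod_cast ha1
    have : (2 * k * al G S : ℝ) ≤ S.card := by
      have : 0 ≤ ε * k * (al G S - 1) := by
        apply mul_nonneg (by positivity); linarith
      rw [hb] at hlob; nlinarith
    exact_mod_cast this
  · intro I h1 h2
    by_cases hne : I.Nonempty
    · have h3 := hnbr I h1 h2 hne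
      have hc : (1:ℝ) ≤ I.card := by exact_mod_cast card_pos.mpr hne
      have : (2 * k * I.card : ℝ) ≤ (NS G S I).card := by
        have : 0 ≤ ε * k * (I.card - 1) := by
          apply mul_nonneg (by positivity); linarith
        rw [hb] at h3; nlinarith
      exact_mod_cast this
    · rw [not_nonempty_iff_eq_empty] at hne
      rw [hne]; simp
  · intro v hv
    have h3 := hnbr {v} (by simpa using hv) (by intro x hx y hy; simp at hx hy; simp [hx, hy]) (by simp)
    have : (2 * k + 3 * d : ℝ) ≤ (NS G S {v}).card := by
      rw [hb] at h3; simp at h3; nlinarith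
    exact_mod_cast this
  · intro A B F hA hB hS3 hdis hAne hBne hno
    have hx := al_pos (G := G) hAne
    have hy := al_pos (G := G) hBne
    have h1 := hlt A hA hAne (by
      intro h; obtain ⟨z, hz⟩ := hBne
      exact Finset.disjoint_left.mp hdis (by rw [h]; exact hB hz) hz)
    have h2 := hlt B hB hBne (by
      intro h; obtain ⟨z, hz⟩ := hAne
      exact Finset.disjoint_left.mp hdis hz (by rw [h]; exact hA hz))
    have h3 := ff_super (b := b) (δ := δ) hg0 hx hy
    have h4 := fmono _ _ (al_add hA hB hdis hno)
    have h5 : S.card ≤ A.card + B.card + F.card :=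
      (card_le_card hS3).trans ((card_union_le _ _).trans (Nat.add_le_add_right (card_union_le _ _) _))
    have h5r : (S.card:ℝ) ≤ A.card + B.card + F.card := by exact_mod_cast h5
    have h6 : δ + g * (min (al G A) (al G B) : ℕ) < F.card := by linarith
    have h7 : 0 ≤ g * (min (al G A) (al G B) : ℕ) := by positivity
    constructor
    · have : (d:ℝ) < F.card := by linarith
      exact_mod_cast this
    · have h8 : min A.card B.card ≤ 4 * k * min (al G A) (al G B) := by
        have hA4 := hhi A hA
        have hB4 := hhi B hB
        rcases le_total (al G A) (al G B) with h | h
        · rw [min_eq_left h]; exact (min_le_left _ _).trans hA4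
        · rw [min_eq_right h]; exact (min_le_right _ _).trans hB4
      have h8r : ((min A.card B.card : ℕ) : ℝ) ≤ 4 * k * (min (al G A) (al G B) : ℕ) := by exact_mod_cast h8
      have h9 : (4:ℝ) * k = (8 * L / ε) * g := by rw [hg]; field_simp; norm_num
      have h10 : ((min A.card B.card : ℕ) : ℝ) ≤ Λ * F.card := by
        calc ((min A.card B.card : ℕ) : ℝ) ≤ 4 * k * (min (al G A) (al G B) : ℕ) := h8r
          _ = (8 * L / ε) * (g * (min (al G A) (al G B) : ℕ)) := by rw [h9]; ring
          _ ≤ (8 * L / ε) * F.card := by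
            apply mul_le_mul_of_nonneg_left _ (by positivity); linarith
          _ ≤ Λ * F.card := by
            apply mul_le_mul_of_nonneg_right hΛ (by positivity)
      exact_mod_cast h10

end PC

namespace PC
open scoped Classical
variable {V : Type} {G : SimpleGraph V}

lemma ham_seq [Fintype V] (h : IsHamiltonianGraph G) : ∃ (w : ℕ → V),
    0 < Fintype.card V ∧ (∀ m, w (m + Fintype.card V) = w m) ∧ (∀ m, G.Adj (w m) (w (m+1))) ∧
    (∀ m m', m < m' → m' < m + Fintype.card V → w m ≠ w m') := by
  obtain ⟨v, c, hc, hall⟩ := h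
  have h3 := hc.three_le_length
  have hinj := hc.getVert_injOn'
  have hn : Fintype.card V = c.length := by
    have h1 : (univ : Finset V) = (range c.length).image c.getVert := by
      apply subset_antisymm _ (subset_univ _)
      intro u _
      obtain ⟨m, hm, hm'⟩ := (Walk.mem_support_iff_exists_getVert).mp (hall u)
      rw [mem_image]
      rcases Nat.lt_or_ge m c.length with h | h
      · exact ⟨m, by simpa using h, hm⟩
      · have : m = c.length := by omega
        refine ⟨0, by simp; omega, ?_⟩
        rw [← hm, this]; simp
    rw [← card_univ, h1, card_image_of_injOn, card_range]
    intro x hx y hy hxy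
    simp only [coe_range, Set.mem_Iio] at hx hy
    exact hinj (by simp only [Set.mem_ofPred_eq]; omega) (by simp only [Set.mem_ofPred_eq]; omega) hxy
  refine ⟨fun i => c.getVert (i % c.length), by omega, ?_, ?_, ?_⟩
  · intro m; rw [hn]; simp
  · intro m
    have hlt : m % c.length < c.length := Nat.mod_lt _ (by omega)
    have := c.adj_getVert_succ hlt
    simp only
    rw [Nat.add_mod]
    rw [Nat.mod_eq_of_lt (show 1 < c.length by omega)]
    by_cases he : m % c.length + 1 = c.length
    · rw [he] at this
      rw [he]; simpa using this
    · rw [Nat.mod_eq_of_lt (show m % c.length + 1 < c.length by omega)]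
      exact this
  · intro m m' h1 h2 he
    rw [hn] at h2
    have hlt : m % c.length < c.length := Nat.mod_lt _ (by omega)
    have hlt' : m' % c.length < c.length := Nat.mod_lt _ (by omega)
    have := hinj (by simp only [Set.mem_ofPred_eq]; omega) (by simp only [Set.mem_ofPred_eq]; omega) he
    have hdvd := (Nat.modEq_iff_dvd' h1.le).mp this
    have := Nat.le_of_dvd (by omega) hdvd
    omega

lemma ham_seg [Fintype V] (h : IsHamiltonianGraph G) (S : Finset V) (ℓ β : ℕ)
    (hb : ℓ * S.card ≤ Fintype.card V * β) (hS : β + 2 ≤ S.card) :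
    ∃ x ∈ S, ∃ y ∈ S, x ≠ y ∧ ∃ Q q, ℓ ≤ q ∧ HP G Q x y q ∧ (Q ∩ S).card ≤ β + 2 := by
  obtain ⟨w0, hn0, hper0, hadj0, hinj0⟩ := ham_seq h
  set n := Fintype.card V with hn
  have hcnt : ∀ m, ((range n).filter (fun i => w0 (i + m) ∈ S)).card ≤ S.card := by
    intro m
    apply card_le_card_of_injOn (fun i => w0 (i + m))
    · intro i hi; simp at hi; exact hi.2
    · intro i hi j hj hij
      simp at hi hj
      by_contra hne
      rcases Nat.lt_or_ge i j with h | h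
      · exact hinj0 _ _ (by omega) (by omega) hij
      · exact hinj0 _ _ (show j + m < i + m by omega) (by omega) hij.symm
  have hsum : ∑ i ∈ range n, ((range ℓ).filter (fun m => w0 (i + m) ∈ S)).card ≤ ∑ i ∈ range n, β := by
    calc ∑ i ∈ range n, ((range ℓ).filter (fun m => w0 (i + m) ∈ S)).card
        = ∑ m ∈ range ℓ, ((range n).filter (fun i => w0 (i + m) ∈ S)).card := by
          simp only [card_filter]; rw [sum_comm]
      _ ≤ ∑ m ∈ range ℓ, S.card := sum_le_sum (fun m _ => hcnt m)
      _ ≤ ∑ i ∈ range n, β := by simpa using hb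
  obtain ⟨i0, -, hi0⟩ := exists_le_of_sum_le (by simp; omega) hsum
  -- shift
  let w : ℕ → V := fun m => w0 (i0 + m)
  have hper : ∀ m, w (m + n) = w m := fun m => by simp only [w]; rw [← add_assoc, hper0]
  have hadj : ∀ m, G.Adj (w m) (w (m+1)) := fun m => hadj0 _
  have hinj : ∀ m m', m < m' → m' < m + n → w m ≠ w m' := fun m m' h1 h2 => hinj0 _ _ (by omega) (by omega)
  have hwin : ((range ℓ).filter (fun m => w m ∈ S)).card ≤ β := hi0
  have hsurj : (range n).image w = univ := by
    apply eq_univ_of_card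
    rw [card_image_of_injOn, card_range]
    intro i hi j hj hij
    simp at hi hj
    by_contra hne
    rcases Nat.lt_or_ge i j with h | h
    · exact hinj _ _ h (by omega) hij
    · exact hinj j i (by omega) (by omega) hij.symm
  let T := (Ico ℓ n).filter (fun m => w m ∈ S)
  have hT : 2 ≤ T.card := by
    have h1 : S ⊆ (((range ℓ).filter (fun m => w m ∈ S)) ∪ T).image w := by
      intro z hz
      have : z ∈ (range n).image w := by rw [hsurj]; simp
      obtain ⟨m, hm, rfl⟩ := mem_image.mp this
      apply mem_image_of_mem
      simp only [mem_union, T, mem_filter, mem_range, mem_Ico] at *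
      by_cases m < ℓ
      · left; exact ⟨by assumption, hz⟩
      · right; exact ⟨⟨by omega, hm⟩, hz⟩
    have h2 := (card_le_card h1).trans (card_image_le.trans (card_union_le _ _))
    omega
  have hTne : T.Nonempty := card_pos.mp (by omega)
  set jy := T.min' hTne with hjy
  set jx := T.max' hTne with hjx
  have hyT : jy ∈ T := T.min'_mem _
  have hxT : jx ∈ T := T.max'_mem _
  have hlt : jy < jx := T.min'_lt_max'_of_card hT
  have hyT' := hyT
  have hxT' := hxT
  simp only [T, mem_filter, mem_Ico] at hyT' hxT'
  obtain ⟨⟨hy1, hy2⟩, hyS⟩ := hyT'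
  obtain ⟨⟨hx1, hx2⟩, hxS⟩ := hxT'
  refine ⟨w jx, hxS, w jy, hyS, (hinj _ _ hlt (by omega)).symm, (Icc jx (jy + n)).image w, jy + n - jx, by omega, ?_, ?_⟩
  · have := HP.of_seq (G := G) (X := (Icc jx (jy + n)).image w) w jx (jy + n - jx) (fun m _ _ => hadj m)
      (fun m m' h1 h2 h3 => hinj _ _ h2 (by omega)) (fun m h1 h2 => mem_image_of_mem _ (by simp; omega))
    rwa [show jx + (jy + n - jx) = jy + n by omega, hper] at this
  · have hsub : (Icc jx (jy + n)).image w ∩ S ⊆ ((range ℓ).filter (fun m => w m ∈ S)).image w ∪ {w jx, w jy} := by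
      intro z hz
      rw [mem_inter, mem_image] at hz
      obtain ⟨⟨m, hm, rfl⟩, hzS⟩ := hz
      rw [mem_Icc] at hm
      rcases Nat.lt_or_ge m n with h | h
      · have : m ∈ T := by simp only [T, mem_filter, mem_Ico]; exact ⟨⟨by omega, h⟩, hzS⟩
        have := T.le_max' m this
        have : m = jx := by omega
        simp [this]
      · obtain ⟨m, rfl⟩ := Nat.exists_eq_add_of_le' h
        rw [hper] at hzS ⊢
        rcases Nat.lt_or_ge m ℓ with h' | h'
        · apply mem_union_left; apply mem_image_of_mem; simp [h', hzS]
        · have : m ∈ T := by simp only [T, mem_filter, mem_Ico]; exact ⟨⟨by omega, by omega⟩, hzS⟩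
          have := T.min'_le m this
          have : m = jy := by omega
          simp [this]
    refine (card_le_card hsub).trans ((card_union_le _ _).trans ?_)
    exact Nat.add_le_add (card_image_le.trans hwin) card_le_two

lemma Good.conn {S : Finset V} {a k d Λ : ℕ} (hg : Good G S a k d Λ) {F : Finset V} (hF : (F ∩ S).card ≤ d) :
    Conn G (S \ F) := by
  intro A hA hne hneq
  by_contra hcon
  push Not at hcon
  have h := hg.cut A ((S \ F) \ A) (F ∩ S) (hA.trans sdiff_subset) (sdiff_subset.trans sdiff_subset) (by
    intro z hz; simp only [mem_union, mem_sdiff, mem_inter]; tauto) disjoint_sdiff hne (by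
    rw [sdiff_nonempty]; intro h; exact hneq (subset_antisymm hA h)) (by
    intro x hx y hy; rw [mem_sdiff] at hy; exact hcon x hx y hy.1 hy.2)
  omega

lemma Good.nb {S : Finset V} {a k d Λ : ℕ} (hg : Good G S a k d Λ) {F : Finset V} {v : V} (hv : v ∈ S)
    {f : ℕ} (hF : (F ∩ S).card ≤ f) : 2 * k + 3 * d ≤ ((S \ F).filter (fun u => G.Adj v u)).card + f + 1 := by
  have h1 := hg.deg v hv
  have h2 : NS G S {v} ⊆ insert v ((F ∩ S) ∪ (S \ F).filter (fun u => G.Adj v u)) := by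
    intro z hz
    simp only [NS, mem_filter, mem_singleton, exists_eq_left] at hz
    simp only [mem_insert, mem_union, mem_inter, mem_filter, mem_sdiff]
    tauto
  have h3 := (card_le_card h2).trans (card_insert_le _ _)
  have h4 := card_union_le (F ∩ S) ((S \ F).filter (fun u => G.Adj v u))
  omega

end PC

namespace PC
open scoped Classical
variable {V : Type} {G : SimpleGraph V}

lemma HP.self_zero {X : Finset V} {x : V} {q : ℕ} (h : HP G X x x q) : q = 0 := by
  obtain ⟨p, h1, h2, h3⟩ := h
  rw [Walk.isPath_iff_eq_nil] at h1
  rw [← h3, h1]; rfl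

lemma Good.deg_card {S : Finset V} {a k d Λ : ℕ} (hg : Good G S a k d Λ) : 2 * k + 3 * d ≤ S.card := by
  have h1 := hg.lo
  have h2 := hg.a1
  have h3 := hg.ak
  have : S.Nonempty := card_pos.mp (by nlinarith)
  obtain ⟨v, hv⟩ := this
  exact (hg.deg v hv).trans (card_le_card (filter_subset _ _))

lemma card_un (A B S : Finset V) : ((A ∪ B) ∩ S).card ≤ (A ∩ S).card + B.card := by
  rw [union_inter_distrib_right]
  exact (card_union_le _ _).trans (Nat.add_le_add_left (card_le_card inter_subset_left) _)

lemma small_case [Fintype V] {S : Finset V} {a k d Λ : ℕ} (hg : Good G S a k d Λ) (hI : IndepNumLE G k)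
    (hH : IsHamiltonianGraph G) (ℓ β : ℕ) (hb : ℓ * S.card ≤ Fintype.card V * β)
    (hd : β + 8 * a + 20 ≤ d) (ha : (2 * a + 1) * a ≤ 2 * k) (hℓ : 2 * k + 2 * a + 20 ≤ ℓ) :
    HasCycleLength G ℓ := by
  have hSc := hg.deg_card
  obtain ⟨x, hx, y, hy, hxy, Q, q, hq, hQ, hQS⟩ := ham_seg hH S ℓ β hb (by omega)
  have hxQ := hQ.mem_left
  have hyQ := hQ.mem_right
  -- v
  have h1 := hg.nb hx hQS
  obtain ⟨v, hv⟩ : ((S \ Q).filter (fun u => G.Adj x u)).Nonempty := card_pos.mp (by omega)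
  simp only [mem_filter, mem_sdiff] at hv
  obtain ⟨⟨hvS, hvQ⟩, hxv⟩ := hv
  have hF1 := card_un Q {v} S
  rw [card_singleton] at hF1
  have h1 := hg.nb (F := Q ∪ {v}) hy (hF1.trans (Nat.add_le_add_right hQS 1))
  obtain ⟨y', hy'⟩ : ((S \ (Q ∪ {v})).filter (fun u => G.Adj y u)).Nonempty := card_pos.mp (by omega)
  simp only [mem_filter, mem_sdiff, mem_union, mem_singleton, not_or] at hy'
  obtain ⟨⟨hyS', hyQ', hyv'⟩, hyy'⟩ := hy'
  have hF2 := card_un (Q ∪ {v}) {y'} S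
  rw [card_singleton] at hF2
  have h1 := hg.nb (F := Q ∪ {v} ∪ {y'}) hvS (f := β + 4) (by omega)
  obtain ⟨m, M, hMA, hmM, hMc, hMp⟩ := fine_path (G := G) (r := 2 * a + 1) (a := a)
    (A := (S \ (Q ∪ {v} ∪ {y'})).filter (fun u => G.Adj v u))
    (fun I h1 h2 => hg.ind I (h1.trans ((filter_subset _ _).trans sdiff_subset)) h2) (by omega)
  have hM : ∀ z ∈ M, z ∈ S ∧ z ∉ Q ∧ z ≠ v ∧ z ≠ y' ∧ G.Adj v z := by
    intro z hz
    have := hMA hz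
    simp only [mem_filter, mem_sdiff, mem_union, mem_singleton, not_or] at this
    tauto
  have hF3 := card_un (Q ∪ {v}) M S
  have hF4 := card_un (Q ∪ {v} ∪ M) {y'} S
  rw [card_singleton] at hF4
  have hmS := (hM m hmM).1
  have h1 := hg.nb (F := Q ∪ {v} ∪ M ∪ {y'}) hmS (f := β + 3 + (2 * a + 2) + 1) (by omega)
  obtain ⟨v2, hv2⟩ : ((S \ (Q ∪ {v} ∪ M ∪ {y'})).filter (fun u => G.Adj m u)).Nonempty := card_pos.mp (by omega)
  rw [mem_filter] at hv2
  obtain ⟨hv2H, hmv2⟩ := hv2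
  have hHc : Conn G (S \ (Q ∪ {v} ∪ M ∪ {y'})) := hg.conn (by omega)
  obtain ⟨U, hUH, hv2U, hUc, hUcard, I, hIU, hInd, hIdom⟩ := grow_set hHc hv2H a
  have hdom : ∀ z ∈ S \ (Q ∪ {v} ∪ M ∪ {y'}), z ∈ I ∨ ∃ u ∈ I, G.Adj u z := by
    rcases hIdom with h | h
    · have := hg.ind I (hIU.trans (hUH.trans sdiff_subset)) hInd
      omega
    · exact h
  have hU : ∀ z ∈ U, z ∈ S ∧ z ∉ Q ∧ z ≠ v ∧ z ∉ M ∧ z ≠ y' := by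
    intro z hz
    have := hUH hz
    simp only [mem_sdiff, mem_union, mem_singleton, not_or] at this
    tauto
  have hF5 := card_un (Q ∪ {v} ∪ M) U S
  have hyW : y' ∈ S \ (Q ∪ {v} ∪ M ∪ U) := by
    simp only [mem_sdiff, mem_union, mem_singleton, not_or]
    exact ⟨hyS', ⟨⟨hyQ', hyv'⟩, fun h => (hM _ h).2.2.2.1 rfl⟩, fun h => (hU _ h).2.2.2.2 rfl⟩
  have hgr := greedy (G := G) (A := S \ (Q ∪ {v} ∪ M ∪ U)) (r := 2 * k + 1) (by
    intro z hz
    have h1 := hg.nb (F := Q ∪ {v} ∪ M ∪ U) (mem_sdiff.mp hz).1 (f := β + 3 + (2 * a + 2) + 2 * (a+1)) (by omega)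
    omega) hyW
  obtain ⟨q', hq1, hq2, hQ'⟩ := HP.window hI (ℓ - 2 * a - 7) (by omega) q hQ (by omega)
  obtain ⟨p, hp⟩ := hgr (ℓ - 2 * a - 6 - q') (by omega)
  have hpy : p ≠ y' := by
    rintro rfl
    have := hp.self_zero
    omega
  have hpW := hp.mem_right
  simp only [mem_sdiff, mem_union, mem_singleton, not_or] at hpW
  obtain ⟨u, huI, hup⟩ : ∃ u ∈ I, G.Adj u p := by
    rcases hdom p (by
      simp only [mem_sdiff, mem_union, mem_singleton, not_or]; tauto) with h | h
    · exact absurd (hIU h) hpW.2.2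
    · exact h
  obtain ⟨e, he, hePath⟩ := hUc.path hv2U (hIU huI)
  obtain ⟨z, hz⟩ := hMp (2 * a + 1 - e) (by omega)
  have hvz := (hM z hz.mem_right).2.2.2.2
  have hP2 := HP.cons hvz hz.symm (fun h => (hM v h).2.2.1 rfl)
  have hA := hQ'.symm.joinE hxv hP2 (by
    rw [Finset.disjoint_left]; intro t ht ht'
    rcases mem_insert.mp ht' with rfl | h
    · exact hvQ ht
    · exact (hM t h).2.1 ht)
  have hB := hA.joinE hmv2 hePath (by
    rw [Finset.disjoint_right]; intro t ht ht'
    have := hU t ht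
    simp only [mem_union, mem_insert] at ht'
    tauto)
  have hC := hB.joinE hup hp.symm (by
    rw [Finset.disjoint_right]; intro t ht ht'
    simp only [mem_sdiff, mem_union, mem_singleton, not_or] at ht
    simp only [mem_union, mem_insert] at ht'
    tauto)
  have hcyc := hC.cycle (by omega) hyy'.symm
  convert hcyc using 1
  omega

end PC

namespace PC
open scoped Classical
variable {V : Type} {G : SimpleGraph V}

/-- giant component of `S \ F` -/
structure Giant (G : SimpleGraph V) (S F C : Finset V) (K0 : ℕ) : Prop where
  sub : C ⊆ S \ F
  conn : Conn G C
  closed : ∀ x ∈ C, ∀ y ∈ S \ F, y ∉ C → ¬ G.Adj x y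
  small : ((S \ F) \ C).card ≤ K0

lemma Giant.size {S F C : Finset V} {K0 f : ℕ} (h : Giant G S F C K0) (hF : (F ∩ S).card ≤ f) :
    S.card ≤ C.card + K0 + f := by
  have h1 : S ⊆ C ∪ ((S \ F) \ C) ∪ (F ∩ S) := by
    intro z hz; simp only [mem_union, mem_sdiff, mem_inter]; tauto
  have h2 := (card_le_card h1).trans (card_union_le _ _)
  have h3 := card_union_le C ((S \ F) \ C)
  have := h.small
  omega

lemma giant_exists {S F : Finset V} {a k d Λ Fm : ℕ} (hg : Good G S a k d Λ) (hF : (F ∩ S).card ≤ Fm)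
    (hS : Fm + 3 * (Λ * Fm) < S.card) : ∃ C, Giant G S F C (Λ * Fm) := by
  let P := (S \ F).powerset.filter (fun C => (∀ x ∈ C, ∀ y ∈ S \ F, y ∉ C → ¬ G.Adj x y) ∧
    ((S \ F) \ C).card ≤ Λ * Fm)
  have hPne : P.Nonempty := ⟨S \ F, by
    simp only [P, mem_filter, mem_powerset]
    exact ⟨subset_rfl, fun x _ y h1 h2 => absurd h1 h2, by simp⟩⟩
  obtain ⟨C, hC, hmin⟩ := P.exists_min_image card hPne
  simp only [P, mem_filter, mem_powerset] at hC hmin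
  obtain ⟨hsub, hcl, hsm⟩ := hC
  have key : ∀ A ⊆ C, A.Nonempty → A ≠ C → (∀ u ∈ A, ∀ w ∈ C, w ∉ A → ¬ G.Adj u w) → A.card ≤ Λ * Fm := by
    intro A hA hne hneq hno
    have hAcl : ∀ x ∈ A, ∀ y ∈ S \ F, y ∉ A → ¬ G.Adj x y := by
      intro x hx y hy hyA
      by_cases hyC : y ∈ C
      · exact hno x hx y hyC hyA
      · exact hcl x (hA hx) y hy hyC
    have hB : ((S \ F) \ A).Nonempty := by
      rw [sdiff_nonempty]; intro h
      exact hneq (subset_antisymm hA (hsub.trans h))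
    have h := (hg.cut A ((S \ F) \ A) (F ∩ S) (hA.trans (hsub.trans sdiff_subset))
      (sdiff_subset.trans sdiff_subset) (by
        intro z hz; simp only [mem_union, mem_sdiff, mem_inter]; tauto) disjoint_sdiff hne hB (by
        intro x hx y hy; rw [mem_sdiff] at hy; exact hAcl x hx y hy.1 hy.2)).2
    have h' : min A.card ((S \ F) \ A).card ≤ Λ * Fm := h.trans (Nat.mul_le_mul_left _ hF)
    by_contra hcon
    have h2 : ((S \ F) \ A).card ≤ Λ * Fm := by
      rcases min_le_iff.mp h' with h | h
      · omega
      · exact h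
    have := hmin A ⟨hA.trans hsub, hAcl, h2⟩
    exact hneq (eq_of_subset_of_card_le hA this)
  refine ⟨C, hsub, ?_, hcl, hsm⟩
  intro A hA hne hneq
  by_contra hcon
  push Not at hcon
  have h1 := key A hA hne hneq hcon
  have h2 := key (C \ A) sdiff_subset (by
    rw [sdiff_nonempty]; intro h; exact hneq (subset_antisymm hA h)) (by
    intro h; obtain ⟨z, hz⟩ := hne
    have : z ∈ C \ A := by rw [h]; exact hA hz
    exact (mem_sdiff.mp this).2 hz) (by
    intro u hu w hw hwn h
    rw [mem_sdiff] at hu hwn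
    have hwA : w ∈ A := by by_contra h'; exact hwn ⟨hw, h'⟩
    exact hcon w hwA u hu.1 hu.2 h.symm)
  have h3 : S ⊆ A ∪ (C \ A) ∪ ((S \ F) \ C) ∪ (F ∩ S) := by
    intro z hz; simp only [mem_union, mem_sdiff, mem_inter]; tauto
  have h4 := (card_le_card h3).trans (card_union_le _ _)
  have h5 := card_union_le (A ∪ (C \ A)) ((S \ F) \ C)
  have h6 := card_union_le A (C \ A)
  omega

lemma giant_nested {S F F' C C' : Finset V} {K0 f : ℕ} (h : Giant G S F C K0) (h' : Giant G S F' C' K0)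
    (hFF : F ⊆ F') (hF : (F' ∩ S).card ≤ f) (hS : f + 2 * K0 < S.card) : C' ⊆ C := by
  have h1 := h'.size hF
  have hsub : C' ⊆ S \ F := h'.sub.trans (sdiff_subset_sdiff subset_rfl hFF)
  by_contra hcon
  have hne : (C' ∩ C).Nonempty := by
    rw [nonempty_iff_ne_empty]
    intro he
    have : C' ⊆ (S \ F) \ C := by
      intro z hz
      rw [mem_sdiff]
      refine ⟨hsub hz, fun hzC => ?_⟩
      have : z ∈ C' ∩ C := mem_inter.mpr ⟨hz, hzC⟩
      rw [he] at this; simp at this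
    have := card_le_card this
    have := h.small
    omega
  obtain ⟨u, hu, w, hw, hwn, huw⟩ := h'.conn (C' ∩ C) inter_subset_left hne (by
    intro he; apply hcon; rw [← he]; exact inter_subset_right)
  exact h.closed u (mem_inter.mp hu).2 w (hsub hw) (fun hc => hwn (mem_inter.mpr ⟨hw, hc⟩)) huw

/-- balls -/
noncomputable def bal (G : SimpleGraph V) (C A : Finset V) : ℕ → Finset V
  | 0 => A
  | (i+1) => NS G C (bal G C A i)

lemma bal_sub {C A : Finset V} (hA : A ⊆ C) (i : ℕ) : bal G C A i ⊆ C := by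
  cases i with
  | zero => exact hA
  | succ i => exact filter_subset _ _

lemma bal_mono {C A : Finset V} (hA : A ⊆ C) (i : ℕ) : bal G C A i ⊆ bal G C A (i+1) := by
  intro z hz
  simp only [bal, NS, mem_filter]
  exact ⟨bal_sub hA i hz, Or.inl hz⟩

lemma bal_mono' {C A : Finset V} (hA : A ⊆ C) {i j : ℕ} (h : i ≤ j) : bal G C A i ⊆ bal G C A j := by
  induction j, h using Nat.le_induction with
  | base => exact subset_rfl
  | succ j _ ih => exact ih.trans (bal_mono hA j)

lemma bal_add (C A : Finset V) (i j : ℕ) : bal G C A (i + j) = bal G C (bal G C A i) j := by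
  induction j with
  | zero => rfl
  | succ j ih => rw [← add_assoc]; simp only [bal]; rw [ih]

lemma bal_walk {C A : Finset V} (hA : A ⊆ C) (i : ℕ) {z : V} (hz : z ∈ bal G C A i) :
    ∃ a0 ∈ A, ∃ p : G.Walk a0 z, (∀ v ∈ p.support, v ∈ C) ∧ p.length ≤ i := by
  induction i generalizing z with
  | zero => exact ⟨z, hz, Walk.nil, by simpa using hA hz, by simp⟩
  | succ i ih =>
    simp only [bal, NS, mem_filter] at hz
    rcases hz with ⟨hzC, hz | ⟨u, hu, huz⟩⟩
    · obtain ⟨a0, h1, p, h2, h3⟩ := ih hz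
      exact ⟨a0, h1, p, h2, by omega⟩
    · obtain ⟨a0, h1, p, h2, h3⟩ := ih hu
      refine ⟨a0, h1, p.concat huz, ?_, by simp; omega⟩
      intro v hv
      rw [Walk.support_concat] at hv
      simp at hv
      rcases hv with hv | rfl
      · exact h2 v hv
      · exact hzC

lemma expand {S F C : Finset V} {a k d Λ Fm : ℕ} (hg : Good G S a k d Λ) (hF : (F ∩ S).card ≤ Fm)
    (hC : Giant G S F C (Λ * Fm)) {B : Finset V} (hB : B ⊆ C) (hBc : 2 * (Λ * Fm) ≤ B.card) (hBne : B.Nonempty)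
    (hhalf : 2 * (NS G C B).card ≤ C.card) : 2 * Λ * B.card + B.card ≤ 2 * Λ * (NS G C B).card := by
  have hBB : B ⊆ NS G C B := by
    intro z hz; simp only [NS, mem_filter]; exact ⟨hB hz, Or.inl hz⟩
  have hNC : NS G C B ⊆ C := filter_subset _ _
  have hBc0 := card_le_card hBB
  have hbpos := card_pos.mpr hBne
  have hCR : C.card ≤ (NS G C B).card + ((S \ F) \ NS G C B).card := by
    have : C ⊆ NS G C B ∪ ((S \ F) \ NS G C B) := by
      intro z hz; have := hC.sub hz
      by_cases h : z ∈ NS G C B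
      · exact mem_union_left _ h
      · exact mem_union_right _ (mem_sdiff.mpr ⟨this, h⟩)
    exact (card_le_card this).trans (card_union_le _ _)
  have hcut := (hg.cut B ((S \ F) \ NS G C B) ((F ∩ S) ∪ (NS G C B \ B))
    (hB.trans (hC.sub.trans sdiff_subset)) (sdiff_subset.trans sdiff_subset) (by
      intro z hz; simp only [mem_union, mem_sdiff, mem_inter]; tauto)
    (disjoint_of_subset_left hBB disjoint_sdiff) hBne (card_pos.mp (by omega)) (by
      intro x hx y hy hxy
      rw [mem_sdiff] at hy
      by_cases hyC : y ∈ C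
      · exact hy.2 (by simp only [NS, mem_filter]; exact ⟨hyC, Or.inr ⟨x, hx, hxy⟩⟩)
      · exact hC.closed x (hB hx) y hy.1 hyC hxy)).2
  rw [min_eq_left (by omega)] at hcut
  have h1 := card_union_le (F ∩ S) (NS G C B \ B)
  have h2 : (NS G C B \ B).card + B.card = (NS G C B).card := card_sdiff_add_card_eq_card hBB
  have h3 : B.card ≤ Λ * Fm + Λ * (NS G C B \ B).card := by
    calc B.card ≤ _ := hcut
      _ ≤ Λ * (Fm + (NS G C B \ B).card) := Nat.mul_le_mul_left _ (by omega)
      _ = _ := by ring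
  rw [← h2]
  nlinarith

lemma ball_double {S F C : Finset V} {a k d Λ Fm : ℕ} (hg : Good G S a k d Λ) (hF : (F ∩ S).card ≤ Fm)
    (hC : Giant G S F C (Λ * Fm)) {B : Finset V} (hB : B ⊆ C) (hBc : 2 * (Λ * Fm) ≤ B.card) (hBne : B.Nonempty)
    (hΛ : 1 ≤ Λ)
    (hhalf : 2 * (bal G C B (2 * Λ)).card ≤ C.card) : 2 * B.card ≤ (bal G C B (2 * Λ)).card := by
  have : ∀ i ≤ 2 * Λ, 2 * Λ * B.card + i * B.card ≤ 2 * Λ * (bal G C B i).card := by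
    intro i hi
    induction i with
    | zero => simp [bal]
    | succ i ih =>
      have h0 := ih (by omega)
      have hsub : B ⊆ bal G C B i := bal_mono' (i := 0) hB (Nat.zero_le i)
      have hle := card_le_card hsub
      have h1 := expand hg hF hC (bal_sub hB i) (by omega) (hBne.mono hsub) (by
        have := card_le_card (bal_mono' (G := G) hB hi)
        simp only [bal] at this
        omega)
      simp only [bal]
      have : (i+1) * B.card = i * B.card + B.card := by ring
      omega
  have h := this (2 * Λ) le_rfl
  have h2 : 2 * Λ * (2 * B.card) ≤ 2 * Λ * (bal G C B (2 * Λ)).card := by linarith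
  exact Nat.le_of_mul_le_mul_left h2 (by omega)

lemma ball_big {S F C : Finset V} {a k d Λ Fm : ℕ} (hg : Good G S a k d Λ) (hF : (F ∩ S).card ≤ Fm)
    (hC : Giant G S F C (Λ * Fm)) (hΛ : 1 ≤ Λ) (r : ℕ) {B : Finset V} (hB : B ⊆ C)
    (hBc : 2 * (Λ * Fm) ≤ B.card) (hBne : B.Nonempty)
    (hhalf : 2 * (bal G C B (2 * Λ * r)).card ≤ C.card) : 2 ^ r ≤ (bal G C B (2 * Λ * r)).card := by
  induction r with
  | zero => simpa [bal] using hBne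
  | succ r ih =>
    have hm : bal G C B (2 * Λ * r) ⊆ bal G C B (2 * Λ * (r + 1)) := bal_mono' hB (by nlinarith)
    have hle := card_le_card hm
    have h1 := ih (by omega)
    have hsub : B ⊆ bal G C B (2 * Λ * r) := bal_mono' (i := 0) hB (Nat.zero_le _)
    have hle2 := card_le_card hsub
    have heq : bal G C B (2 * Λ * (r + 1)) = bal G C (bal G C B (2 * Λ * r)) (2 * Λ) := by
      rw [← bal_add]; ring_nf
    rw [heq] at hhalf ⊢
    have h2 := ball_double hg hF hC (bal_sub hB (2 * Λ * r)) (by omega) (hBne.mono hsub) hΛ hhalf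
    rw [pow_succ]; omega

lemma grow_nbr {S F C : Finset V} {a k d Λ Fm K0 : ℕ} (hg : Good G S a k d Λ) (hF : (F ∩ S).card ≤ Fm)
    (hC : Giant G S F C K0) {I : Finset V} (hI : I ⊆ C) (hInd : Ind G I) :
    2 * k * I.card ≤ (NS G C I).card + Fm := by
  have h1 := hg.nbr I (hI.trans (hC.sub.trans sdiff_subset)) hInd
  have h2 : NS G S I ⊆ NS G C I ∪ (F ∩ S) := by
    intro z hz
    simp only [NS, mem_filter] at hz
    simp only [NS, mem_filter, mem_union, mem_inter]
    obtain ⟨hzS, hz⟩ := hz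
    by_cases hzF : z ∈ F
    · exact Or.inr ⟨hzF, hzS⟩
    left
    refine ⟨?_, hz⟩
    rcases hz with hz | ⟨u, hu, huz⟩
    · exact hI hz
    · by_contra hzC
      exact hC.closed u (hI hu) z (mem_sdiff.mpr ⟨hzS, hzF⟩) hzC huz
  have := (card_le_card h2).trans (card_union_le _ _)
  omega

lemma half_ball {S F C : Finset V} {a k d Λ Fm j r : ℕ} (hg : Good G S a k d Λ) (hF : (F ∩ S).card ≤ Fm)
    (hC : Giant G S F C (Λ * Fm)) (hΛ : 1 ≤ Λ) (hj : 2 * (Λ * Fm) + Fm ≤ 2 * k * (j+1)) (hr : S.card < 2 ^ r)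
    {x : V} (hx : x ∈ C) : ∃ B ⊆ C, C.card < 2 * B.card ∧ ∀ z ∈ B, ∃ p : G.Walk x z,
      (∀ v ∈ p.support, v ∈ C) ∧ p.length ≤ 2 * (j + 1) + (1 + 2 * Λ * r) := by
  obtain ⟨Y, hY, hxY, hYc, hYcard, I, hIY, hInd, hor⟩ := grow_set hC.conn hx j
  refine ⟨bal G C Y (1 + 2 * Λ * r), bal_sub hY _, ?_, ?_⟩
  · by_contra hcon
    push Not at hcon
    rw [bal_add] at hcon
    have hY1 : Y ⊆ bal G C Y 1 := bal_mono hY 0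
    have hsub1 : bal G C Y 1 ⊆ C := bal_sub hY 1
    have hINS : NS G C I ⊆ bal G C Y 1 := by
      intro z hz
      change z ∈ NS G C Y
      rw [NS, mem_filter] at hz ⊢
      refine ⟨hz.1, ?_⟩
      rcases hz.2 with h | ⟨u, hu, h⟩
      · exact Or.inl (hIY h)
      · exact Or.inr ⟨u, hIY hu, h⟩
    have hle := card_le_card hINS
    have hle2 : (bal G C Y 1).card ≤ (bal G C (bal G C Y 1) (2 * Λ * r)).card :=
      card_le_card (bal_mono' (G := G) (i := 0) hsub1 (Nat.zero_le (2 * Λ * r)))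
    have hpos : 0 < C.card := card_pos.mpr ⟨x, hx⟩
    rcases hor with h | h
    · have h1 := grow_nbr hg hF hC (hIY.trans hY) hInd
      rw [h] at h1
      have h2 := ball_big hg hF hC hΛ r hsub1 (by omega) ⟨x, hY1 hxY⟩ hcon
      have h3 := card_le_card (hC.sub.trans sdiff_subset)
      omega
    · have : NS G C I = C := filter_true_of_mem h
      rw [this] at hle
      omega
  · intro z hz
    obtain ⟨a0, ha0, p, hp, hpl⟩ := bal_walk hY _ hz
    obtain ⟨q, hq, p', hp1, hp2, hp3⟩ := hYc.path hxY ha0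
    refine ⟨p'.append p, ?_, by rw [Walk.length_append]; omega⟩
    intro v hv
    rw [Walk.mem_support_append_iff] at hv
    rcases hv with hv | hv
    · exact hY (hp2 v hv)
    · exact hp v hv

lemma radius {S F C : Finset V} {a k d Λ Fm j r : ℕ} (hg : Good G S a k d Λ) (hF : (F ∩ S).card ≤ Fm)
    (hC : Giant G S F C (Λ * Fm)) (hΛ : 1 ≤ Λ) (hj : 2 * (Λ * Fm) + Fm ≤ 2 * k * (j+1)) (hr : S.card < 2 ^ r)
    {x y : V} (hx : x ∈ C) (hy : y ∈ C) :
    ∃ q ≤ 2 * (2 * (j + 1) + (1 + 2 * Λ * r)), HP G C x y q := by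
  obtain ⟨B, hB, hBc, hBp⟩ := half_ball hg hF hC hΛ hj hr hx
  obtain ⟨B', hB', hBc', hBp'⟩ := half_ball hg hF hC hΛ hj hr hy
  have : (B ∩ B').Nonempty := by
    rw [← card_pos]
    have h1 := card_union_add_card_inter B B'
    have h2 := card_le_card (union_subset hB hB')
    omega
  obtain ⟨z, hz⟩ := this
  rw [mem_inter] at hz
  obtain ⟨p, hp, hpl⟩ := hBp z hz.1
  obtain ⟨p', hp', hpl'⟩ := hBp' z hz.2
  obtain ⟨q, hq, h⟩ := HP.of_walk (X := C) (p.append p'.reverse) (by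
    intro v hv
    rw [Walk.mem_support_append_iff] at hv
    rcases hv with hv | hv
    · exact hp v hv
    · exact hp' v (by simpa using hv))
  refine ⟨q, hq.trans ?_, h⟩
  rw [Walk.length_append, Walk.length_reverse]; omega

end PC

namespace PC
open scoped Classical
variable {V : Type} {G : SimpleGraph V}

lemma fine_gadget {S : Finset V} {a t s : ℕ} (hrad : ∀ x ∈ S, ∀ y ∈ S, ∃ q ≤ t, HP G S x y q)
    (hind : ∀ I ⊆ S, Ind G I → I.card ≤ a) (hS : t * (s * a) + 1 < S.card) {r : V} (hr : r ∈ S) :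
    ∃ Γ ⊆ S, ∃ z0 i, Γ.card ≤ (s + 1) * (t + 2) ∧ i ≤ t ∧ ∀ φ ≤ s, HP G Γ r z0 (i + φ) := by
  have hex : ∀ z ∈ S, ∃ q, HP G S r z q := fun z hz => by
    obtain ⟨q, -, h⟩ := hrad r hr z hz; exact ⟨q, h⟩
  let D : V → ℕ := fun z => if h : ∃ q, HP G S r z q then Nat.find h else 0
  have hD1 : ∀ z ∈ S, HP G S r z (D z) := by
    intro z hz
    have h := hex z hz
    simp only [D, dif_pos h]
    exact Nat.find_spec h
  have hD2 : ∀ z q, HP G S r z q → D z ≤ q := by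
    intro z q hq
    have h : ∃ q, HP G S r z q := ⟨q, hq⟩
    simp only [D, dif_pos h]
    exact Nat.find_min' h hq
  have hpig : ∃ i ∈ Icc 1 t, s * a < ((S.erase r).filter (fun z => D z = i)).card := by
    apply exists_lt_card_fiber_of_mul_lt_card_of_maps_to
    · intro z hz
      rw [mem_erase] at hz
      rw [mem_Icc]
      constructor
      · by_contra h
        have h0 : D z = 0 := by omega
        have := hD1 z hz.2
        rw [h0] at this
        obtain ⟨p, -, -, hp⟩ := this
        exact hz.1 (Walk.eq_of_length_eq_zero hp).symm
      · obtain ⟨q, hq, h⟩ := hrad r hr z hz.2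
        exact (hD2 z q h).trans hq
    · rw [Nat.card_Icc, card_erase_of_mem hr]
      simp only [Nat.add_sub_cancel]
      omega
  obtain ⟨i, hi, hcard⟩ := hpig
  rw [mem_Icc] at hi
  obtain ⟨z0, M, hMA, hz0, hMc, hMp⟩ := fine_path (G := G)
    (fun I h1 h2 => hind I (h1.trans ((filter_subset _ _).trans (erase_subset _ _))) h2) hcard
  have hM : ∀ m ∈ M, m ∈ S ∧ D m = i := by
    intro m hm
    have := hMA hm
    simp only [mem_filter, mem_erase] at this
    exact ⟨this.1.2, this.2⟩
  have hgeo : ∀ m ∈ M, ∃ X ⊆ S, X.card ≤ t + 1 ∧ HP G X r m i ∧ ∀ v ∈ X, v ∈ M → v = m := by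
    intro m hm
    have h := hD1 m (hM m hm).1
    rw [(hM m hm).2] at h
    obtain ⟨w, hw0, hwq, hadj, hinj, hmem⟩ := h.to_seq
    refine ⟨(range (i+1)).image w, ?_, ?_, ?_, ?_⟩
    · intro z hz
      obtain ⟨b, hb, rfl⟩ := mem_image.mp hz
      exact hmem b (by simp at hb; omega)
    · exact card_image_le.trans (by simp; omega)
    · have := HP.of_seq (G := G) (X := (range (i+1)).image w) w 0 i (fun b _ h => hadj b (by omega))
        (fun b b' _ h h' => hinj b b' h (by omega)) (fun b _ h => mem_image_of_mem _ (by simp; omega))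
      rwa [zero_add, hw0, hwq] at this
    · intro v hv hvM
      obtain ⟨b, hb, rfl⟩ := mem_image.mp hv
      simp at hb
      have hpre := HP.of_seq (G := G) (X := S) w 0 b (fun c _ h => hadj c (by omega))
        (fun c c' _ h h' => hinj c c' h (by omega)) (fun c _ h => hmem c (by omega))
      rw [zero_add, hw0] at hpre
      have := hD2 _ _ hpre
      rw [(hM _ hvM).2] at this
      have : b = i := by omega
      rw [this, hwq]
  choose! X hXS hXc hXp hXM using hgeo
  refine ⟨M ∪ M.biUnion X, ?_, z0, i, ?_, hi.2, ?_⟩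
  · intro z hz
    rw [mem_union, mem_biUnion] at hz
    rcases hz with h | ⟨m, hm, h⟩
    · exact (hM z h).1
    · exact hXS m hm h
  · have h1 := card_union_le M (M.biUnion X)
    have h2 := card_biUnion_le_card_mul M X (t+1) hXc
    have h3 : M.card * (t+1) ≤ (s+1) * (t+1) := Nat.mul_le_mul_right _ hMc
    have : (s+1) * (t+2) = (s+1)*(t+1) + (s+1) := by ring
    omega
  · intro φ hφ
    obtain ⟨m, hm⟩ := hMp φ hφ
    have hmM := hm.mem_right
    have := (hXp m hmM).join hm.symm (fun v h1 h2 => hXM m hmM v h1 h2)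
    apply this.mono
    intro z hz
    rw [mem_union] at hz
    rw [mem_union, mem_biUnion]
    rcases hz with h | h
    · exact Or.inr ⟨m, hmM, h⟩
    · exact Or.inl h

lemma adj_giant {S F C E Y I : Finset V} {a k d Λ Fm j : ℕ} (hg : Good G S a k d Λ) (hF : (F ∩ S).card ≤ Fm)
    (hC : Giant G S F C (Λ * Fm)) (hCne : C.Nonempty) (hj : Λ * Fm + Fm < 2 * k * (j+1))
    (hYF : Y ⊆ F) (hEF : E ⊆ F) (hIS : I ⊆ S) (hIY : I ⊆ Y) (hInd : Ind G I)
    (hor : I.card = j + 1 ∨ ∀ z ∈ S \ E, z ∈ I ∨ ∃ u ∈ I, G.Adj u z) :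
    ∃ u ∈ Y, ∃ c ∈ C, G.Adj u c := by
  have key : ∀ c ∈ C, (c ∈ I ∨ ∃ u ∈ I, G.Adj u c) → ∃ u ∈ Y, ∃ c ∈ C, G.Adj u c := by
    intro c hc h
    rcases h with h | ⟨u, hu, huc⟩
    · exact absurd (hYF (hIY h)) (mem_sdiff.mp (hC.sub hc)).2
    · exact ⟨u, hIY hu, c, hc, huc⟩
  rcases hor with h | h
  · have h1 := hg.nbr I hIS hInd
    rw [h] at h1
    have h2 : ¬ NS G S I ⊆ ((S \ F) \ C) ∪ (F ∩ S) := by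
      intro hs
      have := (card_le_card hs).trans (card_union_le _ _)
      have := hC.small
      omega
    rw [not_subset] at h2
    obtain ⟨c, hc, hcn⟩ := h2
    simp only [NS, mem_filter] at hc
    simp only [mem_union, mem_sdiff, mem_inter] at hcn
    exact key c (by tauto) hc.2
  · obtain ⟨c, hc⟩ := hCne
    exact key c hc (h c (sdiff_subset_sdiff subset_rfl hEF (hC.sub hc)))

lemma grow_path {S F C0 : Finset V} {a k d Λ Fm : ℕ} (hg : Good G S a k d Λ)
    (hS : Fm + 3 * (Λ * Fm) < S.card) (hC0 : Giant G S F C0 (Λ * Fm)) {w0 : V} (hw0 : w0 ∈ C0) (m : ℕ)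
    (hm : F.card + m ≤ Fm) :
    ∃ X C u, X ⊆ S \ F ∧ X.card ≤ m ∧ Giant G S (F ∪ X) C (Λ * Fm) ∧ u ∈ C ∧ HP G (insert u X) w0 u m := by
  induction m with
  | zero => exact ⟨∅, C0, w0, by simp, by simp, by simpa using hC0, hw0, HP.refl (by simp)⟩
  | succ m ih =>
    obtain ⟨X, C, u, hX, hXc, hC, hu, hp⟩ := ih (by omega)
    have hc1 : (F ∪ insert u X).card ≤ Fm := by
      have h1 := card_union_le F (insert u X)
      have h2 := card_insert_le u X
      omega
    have hc2 : ((F ∪ insert u X) ∩ S).card ≤ Fm := (card_le_card inter_subset_left).trans hc1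
    obtain ⟨C', hC'⟩ := giant_exists hg hc2 hS
    have hnest : C' ⊆ C := giant_nested hC hC' (union_subset_union_right (subset_insert _ _)) hc2 (by omega)
    have hu' : u ∉ C' := fun h => by
      have := hC'.sub h
      simp at this
    have hsz := hC'.size hc2
    have hne : C'.Nonempty := card_pos.mp (by omega)
    obtain ⟨v, hv, w, hw, hwn, hvw⟩ := hC.conn C' hnest hne (fun h => hu' (h ▸ hu))
    have hwu : w = u := by
      by_contra hne'
      have h1 := hC.sub hw
      simp only [mem_sdiff, mem_union, not_or] at h1
      refine hC'.closed v hv w ?_ hwn hvw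
      simp only [mem_sdiff, mem_union, mem_insert, not_or]
      tauto
    subst hwu
    have hv' := hC'.sub hv
    simp only [mem_sdiff, mem_union, mem_insert, not_or] at hv'
    have huC := hC.sub hu
    simp only [mem_sdiff, mem_union, not_or] at huC
    refine ⟨insert w X, C', v, ?_, ?_, hC', hv, ?_⟩
    · intro z hz
      rcases mem_insert.mp hz with rfl | h
      · rw [mem_sdiff]; tauto
      · exact hX h
    · have h2 := card_insert_le w X
      omega
    · exact (HP.cons hvw hp.symm (by rw [mem_insert]; tauto)).symm

lemma big_case {S : Finset V} {a k d Λ Fm j r t s : ℕ} (hg : Good G S a k d Λ)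
    (ℓ : ℕ) (hΛ : 1 ≤ Λ) (hFm : 1 ≤ Fm) (hj : 2 * (Λ * Fm) + Fm ≤ 2 * k * (j+1)) (hr : S.card < 2 ^ r)
    (hS : Fm + 3 * (Λ * Fm) < S.card) (ht : t = 2 * (2 * (j + 1) + (1 + 2 * Λ * r)))
    (hs : s = t + 2 * (j + 1)) (hSg : t * (s * a) + 1 < S.card)
    (hd : (s + 1) * (t + 2) + 4 * (j+1) + 5 ≤ d) (hℓF : ℓ + d ≤ Fm) (hℓ : 2 * t + 4 * (j+1) + 10 ≤ ℓ) :
    HasCycleLength G ℓ := by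
  have hKpos : 1 ≤ Λ * Fm := Nat.mul_pos hΛ hFm
  have hrad : ∀ x ∈ S, ∀ y ∈ S, ∃ q ≤ t, HP G S x y q := by
    intro x hx y hy
    have hG : Giant G S ∅ S (Λ * Fm) := by
      refine ⟨by simp, ?_, fun x _ y h1 h2 => absurd (mem_sdiff.mp h1).1 h2, by simp⟩
      have := hg.conn (F := ∅) (by simp)
      simpa using this
    rw [ht]
    exact radius hg (by simp) hG hΛ hj hr hx hy
  obtain ⟨ρ, hρ⟩ : S.Nonempty := card_pos.mp (by omega)
  obtain ⟨Γ, hΓS, z0, i, hΓc, hit, hΓp⟩ := fine_gadget hrad hg.ind hSg hρ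
  have hz0S : z0 ∈ S := hΓS (hΓp 0 (by omega)).mem_right
  have cs : ∀ A : Finset V, (A ∩ S).card ≤ A.card := fun A => card_le_card inter_subset_left
  have h1 := hg.nb (F := Γ) hρ (cs Γ)
  obtain ⟨r1, hr1⟩ : ((S \ Γ).filter (fun u => G.Adj ρ u)).Nonempty := card_pos.mp (by omega)
  simp only [mem_filter, mem_sdiff] at hr1
  obtain ⟨⟨hr1S, hr1Γ⟩, hρr1⟩ := hr1
  have hE1 : (Γ ∪ {r1}).card ≤ Γ.card + 1 := by simpa using card_union_le Γ {r1}
  have h1 := hg.nb (F := Γ ∪ {r1}) hz0S ((cs _).trans hE1)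
  obtain ⟨z1, hz1⟩ : ((S \ (Γ ∪ {r1})).filter (fun u => G.Adj z0 u)).Nonempty := card_pos.mp (by omega)
  rw [mem_filter] at hz1
  obtain ⟨hz1H, hz0z1⟩ := hz1
  obtain ⟨Yz, hYzH, hz1Y, hYzC, hYzc, Iz, hIzY, hIzInd, hIzor⟩ :=
    grow_set (hg.conn (F := Γ ∪ {r1}) ((cs _).trans (by omega))) hz1H j
  have hYz : ∀ v ∈ Yz, v ∈ S ∧ v ∉ Γ ∧ v ≠ r1 := by
    intro v hv
    have := hYzH hv
    simp only [mem_sdiff, mem_union, mem_singleton, not_or] at this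
    tauto
  have hE2 := card_union_le Γ Yz
  have hr1H : r1 ∈ S \ (Γ ∪ Yz) := by
    simp only [mem_sdiff, mem_union, not_or]
    exact ⟨hr1S, hr1Γ, fun h => (hYz r1 h).2.2 rfl⟩
  obtain ⟨Yr, hYrH, hr1Y, hYrC, hYrc, Ir, hIrY, hIrInd, hIror⟩ :=
    grow_set (hg.conn (F := Γ ∪ Yz) ((cs _).trans (by omega))) hr1H j
  have hYr : ∀ v ∈ Yr, v ∈ S ∧ v ∉ Γ ∧ v ∉ Yz := by
    intro v hv
    have := hYrH hv
    simp only [mem_sdiff, mem_union, not_or] at this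
    tauto
  have hE3 := card_union_le (Γ ∪ Yz) Yr
  set F2 := Γ ∪ Yz ∪ Yr with hF2
  have hF2d : F2.card ≤ d := by omega
  have hzF : Yz ⊆ F2 := fun v hv => by simp [hF2, hv]
  have hrF : Yr ⊆ F2 := fun v hv => by simp [hF2, hv]
  have hΓF : Γ ⊆ F2 := fun v hv => by simp [hF2, hv]
  have hzE : Γ ∪ {r1} ⊆ F2 := union_subset hΓF (by simpa using hrF hr1Y)
  have hrE : Γ ∪ Yz ⊆ F2 := union_subset hΓF hzF
  have hF2m : (F2 ∩ S).card ≤ Fm := (cs _).trans (by omega)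
  obtain ⟨C0, hC0⟩ := giant_exists hg hF2m hS
  have hC0ne : C0.Nonempty := by
    have := hC0.size hF2m
    exact card_pos.mp (by omega)
  obtain ⟨y0, hy0, w0, hw0, hy0w0⟩ := adj_giant hg hF2m hC0 hC0ne (by omega) hzF hzE
    (hIzY.trans (fun v hv => (hYz v hv).1)) hIzY hIzInd hIzor
  obtain ⟨e1, he1, hPz⟩ := hYzC.path hz1Y hy0
  obtain ⟨X, C, u, hX, hXc, hC, huC, hPX⟩ := grow_path hg hS hC0 hw0
    (ℓ - i - 4 - e1 - t - 2 * (j+1)) (by omega)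
  have hF3c : ((F2 ∪ X) ∩ S).card ≤ Fm := (cs _).trans (by
    have := card_union_le F2 X
    omega)
  obtain ⟨c2, hc2, c1, hc1, hc21⟩ := adj_giant hg hF3c hC ⟨u, huC⟩ (by omega)
    (hrF.trans subset_union_left) (hrE.trans subset_union_left)
    (hIrY.trans (fun v hv => (hYr v hv).1)) hIrY hIrInd hIror
  obtain ⟨e, he, hPC⟩ := radius hg hF3c hC hΛ hj hr huC hc1
  rw [← ht] at he
  obtain ⟨e2, he2, hPr⟩ := hYrC.path hc2 hr1Y
  have hPΓ := hΓp (t - e + (2 * (j+1) - e2)) (by omega)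
  have hCs : ∀ v ∈ C, v ∉ F2 ∧ v ∉ X := by
    intro v hv
    have := hC.sub hv
    simp only [mem_sdiff, mem_union, not_or] at this
    exact this.2
  have hXs : ∀ v ∈ X, v ∉ F2 := fun v hv => (mem_sdiff.mp (hX hv)).2
  have hXC := hPX.join hPC (by
    intro v h1 h2
    rcases mem_insert.mp h1 with h | h
    · exact h
    · exact absurd h (hCs v h2).2)
  have hXCF : ∀ v ∈ insert u X ∪ C, v ∉ F2 := by
    intro v hv
    rw [mem_union, mem_insert] at hv
    rcases hv with (rfl | h) | h
    · exact (hCs _ huC).1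
    · exact hXs _ h
    · exact (hCs _ h).1
  have hA := hPΓ.joinE hz0z1 hPz (by
    rw [Finset.disjoint_right]; intro v hv; exact (hYz v hv).2.1)
  have hB := hA.joinE hy0w0 hXC (by
    rw [Finset.disjoint_right]; intro v hv hv'
    exact hXCF v hv (hrE hv'))
  have hD := hB.joinE hc21.symm hPr (by
    rw [Finset.disjoint_right]; intro v hv hv'
    rcases mem_union.mp hv' with h | h
    · rcases mem_union.mp h with h | h
      · exact (hYr v hv).2.1 h
      · exact (hYr v hv).2.2 h
    · exact hXCF v h (hrF hv))
  have hcyc := hD.cycle (by omega) hρr1.symm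
  convert hcyc using 1
  omega

end PC

namespace PC
open scoped Classical
variable {V : Type} {G : SimpleGraph V}

lemma log_bound (c : ℕ) : ∃ k₀ : ℕ, ∀ k, k₀ ≤ k → c * (Nat.log 2 k) ^ 4 ≤ k := by
  have h := tendsto_pow_const_div_const_pow_of_one_lt 4 (show (1:ℝ) < 2 by norm_num)
  have hev := h.eventually (gt_mem_nhds (show (0:ℝ) < 1 / (c + 1) by positivity))
  obtain ⟨L0, hL0⟩ := Filter.eventually_atTop.mp hev
  refine ⟨2 ^ L0, fun k hk => ?_⟩
  have hk0 : k ≠ 0 := by have : 0 < 2 ^ L0 := by positivity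
                         omega
  have hL : L0 ≤ Nat.log 2 k := Nat.le_log_of_pow_le (by norm_num) hk
  have h1 := hL0 _ hL
  have h2 : 2 ^ Nat.log 2 k ≤ k := Nat.pow_log_le_self 2 hk0
  refine le_trans ?_ h2
  set L := Nat.log 2 k
  rw [div_lt_div_iff₀ (by positivity) (by positivity)] at h1
  have h3 : (c:ℝ) * L ^ 4 ≤ 2 ^ L := by
    have : (0:ℝ) ≤ (L:ℝ)^4 := by positivity
    nlinarith
  exact_mod_cast h3

set_option maxHeartbeats 1000000 in
lemma main_nat [Fintype V] {k E L a ℓ n : ℕ} {S : Finset V} (hE : 1 ≤ E) (hL : L = Nat.log 2 k) (hL1 : 1 ≤ L)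
    (hk : 100000000000 * E ^ 7 * L ^ 4 ≤ k) (hg : Good G S a k (k / (8 * E)) (8 * L * E))
    (hI : IndepNumLE G k) (hH : IsHamiltonianGraph G) (hn : n = Fintype.card V) (hn2 : 2 * k ^ 2 ≤ n)
    (hℓ1 : 2 * k + 8 * (k / (8 * E)) ≤ ℓ) (hℓ2 : ℓ ≤ 1000 * E ^ 2 * k) : HasCycleLength G ℓ := by
  set d := k / (8 * E) with hd
  obtain ⟨M, hM⟩ : ∃ M, M = L ^ 2 * E ^ 3 := ⟨_, rfl⟩
  obtain ⟨N, hN⟩ : ∃ N, N = L * E ^ 3 := ⟨_, rfl⟩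
  have hN1 : 1 ≤ N := by rw [hN]; exact Nat.mul_pos hL1 (Nat.pow_pos hE)
  have hNM : N ≤ M := by
    rw [hN, hM]; exact Nat.mul_le_mul_right _ (Nat.le_self_pow (by norm_num) L)
  have hE2 : E ≤ E ^ 3 := Nat.le_self_pow (by norm_num) E
  have hE23 : E ^ 2 ≤ E ^ 3 := Nat.pow_le_pow_right hE (by norm_num)
  have hE3M : E ^ 3 ≤ M := by
    rw [hM]; exact Nat.le_mul_of_pos_left _ (Nat.pow_pos hL1)
  have hMM : M ≤ M * M := Nat.le_mul_self M
  have hkd : 10000000000 * (M * M) ≤ d := by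
    rw [hd, Nat.le_div_iff_mul_le (by omega)]
    refine le_trans ?_ hk
    rw [hM]
    have : L ^ 2 * E ^ 3 * (L ^ 2 * E ^ 3) = E^6 * L^4 := by ring
    rw [this]
    have : 10000000000 * (E ^ 6 * L ^ 4) * (8 * E) = 80000000000 * (E ^ 7 * L ^ 4) := by ring
    rw [this]
    have : 100000000000 * E ^ 7 * L ^ 4 = 100000000000 * (E ^ 7 * L ^ 4) := by ring
    rw [this]
    omega
  have hdk : 8 * d ≤ k := by
    have h1 : d * (8 * E) ≤ k := Nat.div_mul_le_self k (8 * E)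
    have h2 : d * 8 ≤ d * (8 * E) := Nat.mul_le_mul_left _ (by omega)
    omega
  have hkpos : 1 ≤ k := by omega
  have hlo := hg.lo
  have hhi := hg.hi
  have ha1 := hg.a1
  have hak := hg.ak
  by_cases hcase : a < 13000 * N
  · -- small
    apply small_case hg hI hH ℓ (2000 * E ^ 2 * a)
    · rw [← hn]
      calc ℓ * S.card ≤ (1000 * E ^ 2 * k) * (4 * k * a) := Nat.mul_le_mul hℓ2 hhi
        _ = (2 * k ^ 2) * (2000 * E ^ 2 * a) := by ring
        _ ≤ n * (2000 * E ^ 2 * a) := Nat.mul_le_mul_right _ hn2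
    · have h1 : E ^ 2 * a ≤ M * (13000 * M) := Nat.mul_le_mul (by omega) (by omega)
      have h2 : 2000 * E ^ 2 * a = 2000 * (E ^ 2 * a) := by ring
      have h3 : M * (13000 * M) = 13000 * (M * M) := by ring
      omega
    · have h1 : a * a ≤ (13000 * M) * (13000 * M) := Nat.mul_le_mul (by omega) (by omega)
      have h2 : (2 * a + 1) * a = 2 * (a * a) + a := by ring
      have h3 : (13000 * M) * (13000 * M) = 169000000 * (M * M) := by ring
      omega
    · omega
  · push Not at hcase
    have hLE : L * E ≤ N := by rw [hN]; exact Nat.mul_le_mul_left _ hE2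
    have hLLE : L * E * L ≤ M := by
      rw [hM]
      have : L * E * L = L ^ 2 * E := by ring
      rw [this]; exact Nat.mul_le_mul_left _ hE2
    have hE2N : E ^ 2 ≤ N := by
      rw [hN]; exact hE23.trans (Nat.le_mul_of_pos_left _ hL1)
    have hΛF : (8 * L * E) * (1001 * E ^ 2 * k) = 8008 * (N * k) := by rw [hN]; ring
    have hF : 1001 * E ^ 2 * k ≤ 1001 * (N * k) := by
      have := Nat.mul_le_mul_right k hE2N
      rw [mul_assoc]; exact Nat.mul_le_mul_left _ this
    have hNk : 13000 * (N * k) ≤ k * a := by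
      have := Nat.mul_le_mul_left k hcase
      have h2 : k * (13000 * N) = 13000 * (N * k) := by ring
      omega
    have hNkpos : 1 ≤ N * k := Nat.mul_pos hN1 hkpos
    obtain ⟨t, ht⟩ : ∃ t, t = 2 * (2 * (9000 * N + 1) + (1 + 2 * (8 * L * E) * (2 * L + 4))) := ⟨_, rfl⟩
    obtain ⟨s, hs⟩ : ∃ s, s = t + 2 * (9000 * N + 1) := ⟨_, rfl⟩
    have htM : t ≤ 40000 * M := by
      have : 2 * (8 * L * E) * (2 * L + 4) = 32 * (L * E * L) + 64 * (L * E) := by ring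
      rw [ht, this]; omega
    have hsM : s ≤ 60000 * M := by omega
    have hts : t * s ≤ 2400000000 * (M * M) := by
      calc t * s ≤ (40000 * M) * (60000 * M) := Nat.mul_le_mul htM hsM
        _ = _ := by ring
    refine big_case (Fm := 1001 * E ^ 2 * k) (j := 9000 * N) (r := 2 * L + 4) hg ℓ ?_ ?_ ?_ ?_ ?_ ht hs ?_ ?_ ?_ ?_
    · exact Nat.mul_pos (Nat.mul_pos (by norm_num) hL1) hE
    · exact Nat.mul_pos (Nat.mul_pos (by norm_num) (Nat.pow_pos hE)) hkpos
    · rw [hΛF]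
      have : 2 * k * (9000 * N + 1) = 18000 * (N * k) + 2 * k := by ring
      omega
    · have h1 : k < 2 ^ (L + 1) := by rw [hL]; exact Nat.lt_pow_succ_log_self (by norm_num) k
      have h2 : 2 ^ (2 * L + 4) = 4 * (2 ^ (L+1) * 2 ^ (L+1)) := by
        rw [← pow_add]; rw [show 2 * L + 4 = 2 + (L + 1 + (L + 1)) by ring, pow_add]; norm_num
      rw [h2]
      have h3 : k * k < 2 ^ (L+1) * 2 ^ (L+1) := Nat.mul_lt_mul'' h1 h1
      have h4 : 4 * k * a ≤ 4 * (k * k) := by rw [mul_assoc]; exact Nat.mul_le_mul_left _ (Nat.mul_le_mul_left _ hak)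
      omega
    · rw [hΛF]
      have : 2 * k * a = 2 * (k * a) := by ring
      omega
    · have h1 : t * (s * a) = (t * s) * a := by ring
      have h2 : t * s + 2 ≤ 2 * k := by omega
      have h3 := Nat.mul_le_mul_right a h2
      have h4 : (t * s + 2) * a = t * s * a + 2 * a := by ring
      omega
    · have h1 : (s + 1) * (t + 2) = t * s + 2 * s + t + 2 := by ring
      omega
    · have : 1001 * E ^ 2 * k = 1000 * E ^ 2 * k + E ^ 2 * k := by ring
      have h2 : k ≤ E ^ 2 * k := Nat.le_mul_of_pos_left _ (Nat.pow_pos hE)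
      omega
    · omega

end PC

/-- Middle range: all cycle lengths from (2+ε)k up to 1000k/ε². -/
theorem stmt14 :
    ∃ ε₀ : ℝ, 0 < ε₀ ∧ ∀ ε : ℝ, 0 < ε → ε < ε₀ →
      ∃ k₀ : ℕ, ∀ k : ℕ, k₀ ≤ k →
        ∀ (V : Type) [Fintype V] (G : SimpleGraph V),
          IsHamiltonianGraph G → IndepNumLE G k →
          (2 + ε) * (k : ℝ) ^ 2 ≤ (Fintype.card V : ℝ) →
          ∀ ℓ : ℕ, (2 + ε) * (k : ℝ) ≤ (ℓ : ℝ) → (ℓ : ℝ) ≤ 1000 * (k : ℝ) / ε ^ 2 →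
            HasCycleLength G ℓ := by
  refine ⟨1, one_pos, fun ε he he1 => ?_⟩
  obtain ⟨E, hE⟩ := exists_nat_ge (1 / ε)
  have hE1 : 1 ≤ E := by
    have : (1:ℝ) ≤ E := le_trans (by rw [le_div_iff₀ he]; linarith) hE
    exact_mod_cast this
  have hEe : 1 ≤ (E:ℝ) * ε := by rwa [div_le_iff₀ he] at hE
  have hEr : (0:ℝ) < E := by exact_mod_cast hE1
  obtain ⟨k₀, hk₀⟩ := PC.log_bound (100000000000 * E ^ 7)
  refine ⟨max k₀ 2, fun k hk V _ G hH hI hn ℓ h1 h2 => ?_⟩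
  have hkk := hk₀ k (le_trans (le_max_left _ _) hk)
  have hk2 : 2 ≤ k := le_trans (le_max_right _ _) hk
  have hd : ((k / (8 * E) : ℕ) : ℝ) ≤ ε * k / 8 := by
    refine le_trans Nat.cast_div_le ?_
    push_cast
    rw [div_le_div_iff₀ (by positivity) (by norm_num)]
    have : (0:ℝ) ≤ k := by positivity
    nlinarith [mul_le_mul_of_nonneg_right hEe this]
  obtain ⟨S, a, hg⟩ := PC.extract (G := G) he he1 hk2 hI hn (k / (8 * E)) (8 * Nat.log 2 k * E) hd (by
    push_cast
    rw [div_eq_mul_one_div]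
    exact mul_le_mul_of_nonneg_left hE (by positivity))
  refine PC.main_nat hE1 rfl (Nat.log_pos (by norm_num) hk2) hkk hg hI hH rfl ?_ ?_ ?_
  · have : (2 * k ^ 2 : ℝ) ≤ Fintype.card V := by
      refine le_trans ?_ hn
      have : 0 ≤ ε * (k:ℝ) ^ 2 := by positivity
      linarith
    exact_mod_cast this
  · have : (2 * k + 8 * (k / (8 * E) : ℕ) : ℝ) ≤ ℓ := by linarith
    exact_mod_cast this
  · have : (ℓ : ℝ) ≤ 1000 * E ^ 2 * k := by
      refine h2.trans ?_
      rw [div_le_iff₀ (by positivity)]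
      have h3 : (1:ℝ) ≤ (E * ε) ^ 2 := one_le_pow₀ hEe
      have h4 : (0:ℝ) ≤ 1000 * k := by positivity
      nlinarith [mul_le_mul_of_nonneg_left h3 h4]
    exact_mod_cast this
end

section
/- There exists a constant C > 0 such that for every positive integer k, every Hamiltonian graph on n ≥ Ck² vertices with independence number at most k is pancyclic. -/
open SimpleGraph Finset

section PathFramework
variable {V : Type} {G : SimpleGraph V}

def IsP (G : SimpleGraph V) (a b : V) (l : List V) : Prop :=
  l.Nodup ∧ l.IsChain G.Adj ∧ l.head? = some a ∧ l.getLast? = some b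

theorem IsP.single (a : V) : IsP G a a [a] := by
  refine ⟨?_, ?_, ?_, ?_⟩ <;> simp

theorem IsP.append {a b c d : V} {l1 l2 : List V} (h1 : IsP G a b l1) (h2 : IsP G c d l2)
    (hbc : G.Adj b c) (hd : ∀ x ∈ l1, x ∉ l2) : IsP G a d (l1 ++ l2) := by
  obtain ⟨n1, c1, s1, e1⟩ := h1
  obtain ⟨n2, c2, s2, e2⟩ := h2
  refine ⟨?_, ?_, ?_, ?_⟩
  · rw [List.nodup_append]
    refine ⟨n1, n2, ?_⟩
    rintro x hx y hy rfl
    exact hd x hx hy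
  · rw [List.isChain_append]
    refine ⟨c1, c2, ?_⟩
    intro x hx y hy
    rw [e1] at hx; rw [s2] at hy
    simp at hx hy
    subst hx; subst hy
    exact hbc
  · rw [List.head?_append, s1]; rfl
  · rw [List.getLast?_append, e2]; rfl

theorem IsP.rev {a b : V} {l : List V} (h : IsP G a b l) : IsP G b a l.reverse := by
  obtain ⟨n1, c1, s1, e1⟩ := h
  refine ⟨List.nodup_reverse.2 n1, ?_, ?_, ?_⟩
  · rw [List.isChain_reverse]
    exact c1.imp (fun x y h => h.symm)
  · rw [List.head?_reverse, e1]
  · rw [List.getLast?_reverse, s1]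

theorem IsP.mem_head {a b : V} {l : List V} (h : IsP G a b l) : a ∈ l :=
  List.mem_of_mem_head? (by rw [h.2.2.1]; rfl)

theorem IsP.mem_last {a b : V} {l : List V} (h : IsP G a b l) : b ∈ l :=
  List.mem_of_mem_getLast? (by rw [h.2.2.2]; rfl)

theorem IsP.eq_cons {a b : V} {l : List V} (h : IsP G a b l) : ∃ t, l = a :: t := by
  cases l with
  | nil => simp [IsP] at h
  | cons x t => 
    have := h.2.2.1
    simp at this
    exact ⟨t, by rw [this]⟩

theorem IsP.eq_concat {a b : V} {l : List V} (h : IsP G a b l) : ∃ t, l = t ++ [b] := by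
  obtain ⟨t, ht⟩ := h.rev.eq_cons
  refine ⟨t.reverse, ?_⟩
  rw [← List.reverse_reverse l, ht]; simp

theorem IsP.tail {a c b : V} {l : List V} (h : IsP G a b (a :: c :: l)) :
    G.Adj a c ∧ IsP G c b (c :: l) ∧ a ∉ c :: l := by
  obtain ⟨n1, c1, s1, e1⟩ := h
  rw [List.isChain_cons_cons] at c1
  rw [List.nodup_cons] at n1
  refine ⟨c1.1, ⟨n1.2, c1.2, rfl, ?_⟩, n1.1⟩
  simpa using e1

theorem IsP.to_walk : ∀ (l : List V) (a b : V), IsP G a b l →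
    ∃ p : G.Walk a b, p.support = l := by
  intro l
  induction l with
  | nil => intro a b h; simp [IsP] at h
  | cons x t ih =>
    intro a b h
    have hx := h.2.2.1
    simp at hx
    subst hx
    cases t with
    | nil =>
      have := h.2.2.2
      simp at this
      subst this
      exact ⟨Walk.nil, rfl⟩
    | cons c t =>
      obtain ⟨h1, h2, h3⟩ := h.tail
      obtain ⟨p, hp⟩ := ih c b h2
      exact ⟨Walk.cons h1 p, by rw [Walk.support_cons, hp]⟩

theorem IsP.close {a b : V} {l : List V} (h : IsP G a b l) (hba : G.Adj b a)
    (hl : 3 ≤ l.length) : HasCycleLength G l.length := by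
  obtain ⟨p, hp⟩ := h.to_walk
  have hlen : p.length + 1 = l.length := by rw [← hp, Walk.length_support]
  have hpath : p.IsPath := Walk.IsPath.mk' (by rw [hp]; exact h.1)
  refine ⟨b, Walk.cons hba p, ?_, by rw [Walk.length_cons, hlen]⟩
  rw [Walk.cons_isCycle_iff]
  refine ⟨hpath, ?_⟩
  intro hmem
  cases p with
  | nil => simp at hlen; omega
  | @cons _ c _ hac q =>
    rw [Walk.edges_cons, List.mem_cons] at hmem
    have hq := (Walk.cons_isPath_iff _ _).1 hpath
    rcases hmem with hmem | hmem
    · have : b = c := by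
        rw [Sym2.eq_iff] at hmem
        rcases hmem with ⟨h1, h2⟩ | ⟨h1, h2⟩
        · exact absurd h1 (by rintro rfl; exact (G.loopless.irrefl _ hba))
        · exact h1
      subst this
      have := Walk.isPath_iff_eq_nil.1 hq.1
      subst this
      simp at hlen; omega
    · exact hq.2 (Walk.snd_mem_support_of_mem_edges _ hmem)

/-- walk cycle to list cycle -/
theorem cycle_to_list {v : V} {c : G.Walk v v} (hc : c.IsCycle) :
    ∃ a b l, IsP G a b l ∧ G.Adj b a ∧ l.length = c.length ∧ ∀ u, u ∈ c.support → u ∈ l := by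
  have h3 := hc.three_le_length
  cases c with
  | nil => simp at h3
  | @cons _ w _ h q =>
    have hq := (Walk.cons_isCycle_iff _ _).1 hc
    refine ⟨w, v, q.support, ⟨hq.1.support_nodup, q.isChain_adj_support, ?_, ?_⟩, h, ?_, ?_⟩
    · rw [Walk.support_eq_cons]; rfl
    · rw [List.getLast?_eq_getLast_of_ne_nil (by simp)]; simp
    · simp
    · intro u hu
      rw [Walk.support_cons, List.mem_cons] at hu
      rcases hu with rfl | hu
      · exact q.end_mem_support
      · exact hu

def seg (v : ℕ → V) (a m : ℕ) : List V := (List.range' a m).map v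

theorem seg_length (v : ℕ → V) (a m : ℕ) : (seg v a m).length = m := by simp [seg]

theorem mem_seg {v : ℕ → V} {a m : ℕ} {x : V} : x ∈ seg v a m ↔ ∃ i, a ≤ i ∧ i < a + m ∧ v i = x := by
  simp [seg, List.mem_range'_1, and_assoc]

theorem isP_seg {v : ℕ → V} {a m : ℕ} (hm : 1 ≤ m)
    (hinj : ∀ i j, a ≤ i → i < a + m → a ≤ j → j < a + m → v i = v j → i = j)
    (hadj : ∀ i, a ≤ i → i + 1 < a + m → G.Adj (v i) (v (i+1))) :
    IsP G (v a) (v (a + m - 1)) (seg v a m) := by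
  induction m generalizing a with
  | zero => omega
  | succ m ih =>
    rcases Nat.eq_zero_or_pos m with rfl | hm'
    · simpa [seg] using IsP.single (G := G) (v a)
    · have h1 := ih (a := a+1) hm' (fun i j h1 h2 h3 h4 => hinj i j (by omega) (by omega) (by omega) (by omega))
        (fun i h1 h2 => hadj i (by omega) (by omega))
      have h2 := (IsP.single (G := G) (v a)).append h1 (hadj a le_rfl (by omega)) (by
        intro x hx hx'
        simp at hx
        subst hx
        obtain ⟨i, h1, h2, h3⟩ := mem_seg.1 hx'
        have := hinj i a (by omega) (by omega) (by omega) (by omega) h3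
        omega)
      have e1 : a + 1 + m - 1 = a + (m+1) - 1 := by omega
      rw [e1] at h2
      have e2 : [v a] ++ seg v (a+1) m = seg v a (m+1) := by
        simp [seg, List.range'_succ]
      rw [e2] at h2
      exact h2

/-- a cycle as a function -/
def CycFun (G : SimpleGraph V) (v : ℕ → V) (n : ℕ) : Prop :=
  (∀ i j, i < n → j < n → v i = v j → i = j) ∧ (∀ i, i + 1 < n → G.Adj (v i) (v (i+1))) ∧
  G.Adj (v (n-1)) (v 0)

theorem isP_to_fun {a b : V} {l : List V} (h : IsP G a b l) :
    ∃ v : ℕ → V, (∀ i j, i < l.length → j < l.length → v i = v j → i = j) ∧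
     (∀ i, i + 1 < l.length → G.Adj (v i) (v (i+1))) ∧ v 0 = a ∧ v (l.length - 1) = b ∧
     ∀ i (hi : i < l.length), v i = l[i] := by
  refine ⟨fun i => l.getD i a, ?_, ?_, ?_, ?_, ?_⟩
  · intro i j hi hj hij
    simp only [List.getD_eq_getElem _ _ hi, List.getD_eq_getElem _ _ hj] at hij
    exact (h.1.getElem_inj_iff).1 hij
  · intro i hi
    simp only [List.getD_eq_getElem _ _ hi, List.getD_eq_getElem _ _ (Nat.lt_of_succ_lt hi)]
    exact List.isChain_iff_getElem.1 h.2.1 i hi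
  · obtain ⟨t, rfl⟩ := h.eq_cons
    rfl
  · obtain ⟨t, rfl⟩ := h.eq_concat
    simp
  · intro i hi
    simp only [List.getD_eq_getElem _ _ hi]

theorem HasCycleLength.cycFun {n : ℕ} (h : HasCycleLength G n) : ∃ v, CycFun G v n ∧ 3 ≤ n := by
  obtain ⟨x, c, hc, rfl⟩ := h
  obtain ⟨a, b, l, hl, hab, hlen, -⟩ := cycle_to_list hc
  obtain ⟨v, h1, h2, h3, h4, -⟩ := isP_to_fun hl
  refine ⟨v, ⟨?_, ?_, ?_⟩, hc.three_le_length⟩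
  · rw [← hlen]; exact h1
  · rw [← hlen]; exact h2
  · rw [← hlen, h3, h4]; exact hab

end PathFramework

section Descend
variable {V : Type} {G : SimpleGraph V}

def Arc (G : SimpleGraph V) (v : ℕ → V) (x x' : ℕ) : Prop :=
  ∃ y, x' = y + 1 ∧ y + 3 ≤ x ∧ G.Adj (v x) (v y)

theorem CycFun.seg {v : ℕ → V} {n : ℕ} (h : CycFun G v n) {a m : ℕ} (hm : 1 ≤ m) (ha : a + m ≤ n) :
    IsP G (v a) (v (a + m - 1)) (seg v a m) := by
  apply isP_seg hm
  · intro i j h1 h2 h3 h4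
    exact h.1 i j (by omega) (by omega)
  · intro i h1 h2
    exact h.2.1 i (by omega)

theorem no_chord {v : ℕ → V} {n : ℕ} (h : CycFun G v n) (hn : 4 ≤ n)
    (hno : ¬ HasCycleLength G (n-1)) (x : ℕ) (hx : x + 2 < n) : ¬ G.Adj (v (x+2)) (v x) := by
  intro hadj
  have h1 := h.seg (a := x+2) (m := n - (x+2)) (by omega) (by omega)
  have h2 := h.seg (a := 0) (m := x+1) (by omega) (by omega)
  have e1 : x + 2 + (n - (x+2)) - 1 = n - 1 := by omega
  have e2 : 0 + (x+1) - 1 = x := by omega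
  rw [e1] at h1
  rw [e2] at h2
  have h3 := h1.append h2 h.2.2 (by
    intro w hw hw'
    obtain ⟨i, a1, a2, a3⟩ := mem_seg.1 hw
    obtain ⟨j, b1, b2, b3⟩ := mem_seg.1 hw'
    have := h.1 i j (by omega) (by omega) (a3.trans b3.symm)
    omega)
  have hl : (_root_.seg v (x+2) (n-(x+2)) ++ _root_.seg v 0 (x+1)).length = n - 1 := by
    rw [List.length_append, seg_length, seg_length]; omega
  have := h3.close hadj.symm (by omega)
  rw [hl] at this
  exact hno this

def RotInv (G : SimpleGraph V) (v : ℕ → V) (x0 x : ℕ) : Prop :=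
  ∃ T h, IsP G h (v x) T ∧ (∀ y, y + 1 = x → G.Adj (v y) h) ∧
    (∀ w ∈ T, ∃ i, x ≤ i ∧ i ≤ x0 ∧ v i = w) ∧ T.length = x0 - x + 1 ∧ x ≤ x0

theorem inv_of_reach {v : ℕ → V} {n : ℕ} (h : CycFun G v n) {x0 : ℕ} (hx0 : x0 < n) {x : ℕ}
    (hr : Relation.ReflTransGen (Arc G v) x0 x) : RotInv G v x0 x := by
  induction hr with
  | refl =>
    refine ⟨[v x0], v x0, IsP.single _, ?_, ?_, ?_, le_rfl⟩
    · rintro y rfl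
      exact h.2.1 y hx0
    · intro w hw
      simp at hw
      exact ⟨x0, le_rfl, le_rfl, hw.symm⟩
    · simp
  | @tail x x' _ harc ih =>
    obtain ⟨T, hh, hT, hadj, hmem, hlen, hle⟩ := ih
    obtain ⟨y, rfl, hy, hxy⟩ := harc
    have h2 := (h.seg (a := y+1) (m := x-1-y) (by omega) (by omega)).rev
    have e2 : y + 1 + (x-1-y) - 1 = x - 1 := by omega
    rw [e2] at h2
    have h3 := hT.rev.append h2 (hadj (x-1) (by omega)).symm (by
      intro w hw hw'
      rw [List.mem_reverse] at hw hw'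
      obtain ⟨i, a1, a2, a3⟩ := hmem w hw
      obtain ⟨j, b1, b2, b3⟩ := mem_seg.1 hw'
      have := h.1 i j (by omega) (by omega) (a3.trans b3.symm)
      omega)
    refine ⟨_, v x, h3, ?_, ?_, ?_, by omega⟩
    · intro z hz
      have : z = y := by omega
      subst this
      exact hxy.symm
    · intro w hw
      rw [List.mem_append, List.mem_reverse, List.mem_reverse] at hw
      rcases hw with hw | hw
      · obtain ⟨i, a1, a2, a3⟩ := hmem w hw
        exact ⟨i, by omega, by omega, a3⟩
      · obtain ⟨i, a1, a2, a3⟩ := mem_seg.1 hw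
        exact ⟨i, by omega, by omega, a3⟩
    · rw [List.length_append, List.length_reverse, List.length_reverse, seg_length, hlen]
      omega

theorem drop_nonadj {v : ℕ → V} {n : ℕ} (h : CycFun G v n) (hn : 4 ≤ n)
    (hno : ¬ HasCycleLength G (n-1)) {x0 x x' : ℕ} (hx0 : x0 + 2 ≤ n)
    (hr : Relation.ReflTransGen (Arc G v) x0 x) (ha : Arc G v x x') :
    ¬ G.Adj (v (x0+1)) (v (x'+1)) := by
  intro hadj0
  obtain ⟨T, hh, hT, hadj, hmem, hlen, hle⟩ := inv_of_reach h (by omega) hr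
  obtain ⟨y, rfl, hy, hxy⟩ := ha
  have h1 := h.seg (a := x0+1) (m := n-1-x0) (by omega) (by omega)
  have e1 : x0 + 1 + (n-1-x0) - 1 = n - 1 := by omega
  rw [e1] at h1
  have h2 := h.seg (a := 0) (m := y+1) (by omega) (by omega)
  have e2 : 0 + (y+1) - 1 = y := by omega
  rw [e2] at h2
  have h4 := (h.seg (a := y+2) (m := x-2-y) (by omega) (by omega)).rev
  have e4 : y + 2 + (x-2-y) - 1 = x - 1 := by omega
  rw [e4] at h4
  have h34 := hT.rev.append h4 (hadj (x-1) (by omega)).symm (by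
      intro w hw hw'
      rw [List.mem_reverse] at hw hw'
      obtain ⟨i, a1, a2, a3⟩ := hmem w hw
      obtain ⟨j, b1, b2, b3⟩ := mem_seg.1 hw'
      have := h.1 i j (by omega) (by omega) (a3.trans b3.symm)
      omega)
  have h12 := h1.append h2 h.2.2 (by
    intro w hw hw'
    obtain ⟨i, a1, a2, a3⟩ := mem_seg.1 hw
    obtain ⟨j, b1, b2, b3⟩ := mem_seg.1 hw'
    have := h.1 i j (by omega) (by omega) (a3.trans b3.symm)
    omega)
  have h5 := h12.append h34 hxy.symm (by
    intro w hw hw'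
    have A : ∃ i, i < n ∧ (x0 < i ∨ i ≤ y) ∧ v i = w := by
      rw [List.mem_append] at hw
      rcases hw with hw | hw
      · obtain ⟨i, a1, a2, a3⟩ := mem_seg.1 hw
        exact ⟨i, by omega, by omega, a3⟩
      · obtain ⟨i, a1, a2, a3⟩ := mem_seg.1 hw
        exact ⟨i, by omega, by omega, a3⟩
    have B : ∃ i, i ≤ x0 ∧ y < i ∧ v i = w := by
      rw [List.mem_append, List.mem_reverse, List.mem_reverse] at hw'
      rcases hw' with hw | hw
      · obtain ⟨i, a1, a2, a3⟩ := hmem w hw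
        exact ⟨i, by omega, by omega, a3⟩
      · obtain ⟨i, a1, a2, a3⟩ := mem_seg.1 hw
        exact ⟨i, by omega, by omega, a3⟩
    obtain ⟨i, a1, a2, a3⟩ := A
    obtain ⟨j, b1, b2, b3⟩ := B
    have := h.1 i j (by omega) (by omega) (a3.trans b3.symm)
    omega)
  have hl : (_root_.seg v (x0+1) (n-1-x0) ++ _root_.seg v 0 (y+1) ++
      (T.reverse ++ (_root_.seg v (y+2) (x-2-y)).reverse)).length = n - 1 := by
    simp only [List.length_append, List.length_reverse, seg_length, hlen]; omega
  have := h5.close hadj0.symm (by omega)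
  rw [hl] at this
  exact hno this

theorem reach_le {v : ℕ → V} {x y : ℕ} (hr : Relation.ReflTransGen (Arc G v) x y) : y ≤ x := by
  induction hr with
  | refl => exact le_rfl
  | tail _ h ih => obtain ⟨y, rfl, hy, -⟩ := h; omega

theorem exists_L {v : ℕ → V} {n k : ℕ} (h : CycFun G v n) (hn : 4 ≤ n)
    (hno : ¬ HasCycleLength G (n-1)) (hk : IndepNumLE G k) :
    ∃ L : ℕ → ℕ, ∀ x, x + 2 ≤ n → 1 ≤ L x ∧ L x ≤ k ∧ ∀ x', Arc G v x x' → L x' + 1 ≤ L x := by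
  classical
  let F : ℕ → Finset (Finset ℕ) := fun x => (range n).powerset.filter (fun t =>
    (∀ i ∈ t, Relation.ReflTransGen (Arc G v) x i) ∧
      ∀ i ∈ t, ∀ j ∈ t, i ≠ j → ¬ G.Adj (v (i+1)) (v (j+1)))
  have hF : ∀ x t, t ∈ F x ↔ t ⊆ range n ∧ (∀ i ∈ t, Relation.ReflTransGen (Arc G v) x i) ∧
      ∀ i ∈ t, ∀ j ∈ t, i ≠ j → ¬ G.Adj (v (i+1)) (v (j+1)) := by
    intro x t; simp [F]
  refine ⟨fun x => (F x).sup Finset.card, ?_⟩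
  intro x hx
  refine ⟨?_, ?_, ?_⟩
  · have : ({x} : Finset ℕ) ∈ F x := by
      rw [hF]
      refine ⟨by simp; omega, ?_, ?_⟩
      · intro i hi; simp at hi; subst hi; exact Relation.ReflTransGen.refl
      · intro i hi j hj hij; simp at hi hj; omega
    exact Finset.le_sup (f := Finset.card) this
  · apply Finset.sup_le
    intro t ht
    rw [hF] at ht
    have hinj : Set.InjOn (fun i => v (i+1)) (t : Set ℕ) := by
      intro i hi j hj hij
      have h1 := reach_le (ht.2.1 i hi)
      have h2 := reach_le (ht.2.1 j hj)
      have := h.1 (i+1) (j+1) (by omega) (by omega) hij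
      omega
    rw [← Finset.card_image_of_injOn hinj]
    apply hk
    intro a ha b hb hab
    rw [Finset.mem_image] at ha hb
    obtain ⟨i, hi, rfl⟩ := ha
    obtain ⟨j, hj, rfl⟩ := hb
    exact ht.2.2 i hi j hj (by rintro rfl; exact hab rfl)
  · intro x' harc
    have hne : (F x').Nonempty := ⟨∅, by rw [hF]; simp⟩
    obtain ⟨t, ht, hteq⟩ := Finset.exists_mem_eq_sup (F x') hne Finset.card
    have hx' : x' < x := by obtain ⟨y, rfl, hy, -⟩ := harc; omega
    rw [hF] at ht
    have hxt : x ∉ t := fun hmem => by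
      have := reach_le (ht.2.1 x hmem)
      omega
    have key : ∀ i ∈ t, ¬ G.Adj (v (x+1)) (v (i+1)) := by
      intro i hi
      have h1 : Relation.TransGen (Arc G v) x i := Relation.TransGen.head' harc (ht.2.1 i hi)
      obtain ⟨z, hz1, hz2⟩ := Relation.TransGen.tail'_iff.1 h1
      exact drop_nonadj h hn hno hx hz1 hz2
    show (F x').sup Finset.card + 1 ≤ (F x).sup Finset.card
    rw [hteq, ← Finset.card_insert_of_notMem hxt]
    apply Finset.le_sup (f := Finset.card)
    rw [hF]
    refine ⟨?_, ?_, ?_⟩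
    · apply Finset.insert_subset (by simp; omega) ht.1
    · intro i hi
      rw [Finset.mem_insert] at hi
      rcases hi with rfl | hi
      · exact Relation.ReflTransGen.refl
      · exact Relation.ReflTransGen.head harc (ht.2.1 i hi)
    · intro i hi j hj hij
      rw [Finset.mem_insert] at hi hj
      rcases hi with rfl | hi
      · rcases hj with rfl | hj
        · exact absurd rfl hij
        · exact key j hj
      · rcases hj with rfl | hj
        · exact fun hh => key i hi hh.symm
        · exact ht.2.2 i hi j hj hij

theorem sum_tele (L : ℕ → ℕ) (m k : ℕ) (hL : ∀ x, x ≤ m → 1 ≤ L x ∧ L x ≤ k) :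
    m + L m ≤ L 0 + ∑ x ∈ range m, ((Icc 1 k).filter (fun j => L x ≤ j ∧ j ≤ L (x+1))).card := by
  induction m with
  | zero => simp
  | succ m ih =>
    have h1 := ih (fun x hx => hL x (by omega))
    rw [Finset.sum_range_succ]
    have h2 : L (m+1) + 1 ≤ L m + ((Icc 1 k).filter (fun j => L m ≤ j ∧ j ≤ L (m+1))).card := by
      have e : (Icc 1 k).filter (fun j => L m ≤ j ∧ j ≤ L (m+1)) = Icc (L m) (L (m+1)) := by
        ext j
        have := hL m (by omega)
        have := hL (m+1) le_rfl
        simp only [Finset.mem_filter, Finset.mem_Icc]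
        omega
      rw [e, Nat.card_Icc]
      omega
    omega

theorem descend {n k : ℕ} (hk : IndepNumLE G k) (hk0 : 0 < k) (hn : 2*k^2 + k + 2 ≤ n)
    (hc : HasCycleLength G n) : HasCycleLength G (n-1) := by
  classical
  by_contra hno
  obtain ⟨v, h, -⟩ := hc.cycFun
  have hk2 : 1 ≤ k^2 := Nat.one_le_pow _ _ hk0
  have hn4 : 4 ≤ n := by omega
  obtain ⟨L, hL⟩ := exists_L h hn4 hno hk
  have hs := sum_tele L (n-2) k (fun x hx => ⟨(hL x (by omega)).1, (hL x (by omega)).2.1⟩)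
  have hU : ∀ j, ((range (n-2)).filter (fun x => L x ≤ j ∧ j ≤ L (x+1))).card ≤ 2*k := by
    intro j
    set U := (range (n-2)).filter (fun x => L x ≤ j ∧ j ≤ L (x+1)) with hUdef
    have hnon : ∀ x ∈ U, ∀ y ∈ U, y + 2 ≤ x → ¬ G.Adj (v x) (v y) := by
      intro x hx y hy hyx hadj
      simp only [hUdef, Finset.mem_filter, Finset.mem_range] at hx hy
      rcases Nat.lt_or_ge (y+2) x with h3 | h3
      · have := (hL x (by omega)).2.2 (y+1) ⟨y, rfl, by omega, hadj⟩
        omega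
      · have : x = y + 2 := by omega
        subst this
        exact no_chord h hn4 hno y (by omega) hadj
    have hpar : ∀ b, (U.filter (fun x => x % 2 = b)).card ≤ k := by
      intro b
      have hinj : Set.InjOn v (U.filter (fun x => x % 2 = b) : Set ℕ) := by
        intro x hx y hy hxy
        simp [hUdef] at hx hy
        exact h.1 x y (by omega) (by omega) hxy
      rw [← Finset.card_image_of_injOn hinj]
      apply hk
      intro a ha c hc hac
      rw [Finset.mem_image] at ha hc
      obtain ⟨x, hx, rfl⟩ := ha
      obtain ⟨y, hy, rfl⟩ := hc
      rw [Finset.mem_filter] at hx hy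
      have hxy : x ≠ y := by rintro rfl; exact hac rfl
      rcases Nat.lt_or_gt_of_ne hxy with h3 | h3
      · exact fun hh => hnon y hy.1 x hx.1 (by omega) hh.symm
      · exact hnon x hx.1 y hy.1 (by omega)
    have h0 := hpar 0
    have h1 := hpar 1
    have hsplit := Finset.card_filter_add_card_filter_not (s := U) (fun x => x % 2 = 0)
    have : U.filter (fun x => ¬ x % 2 = 0) = U.filter (fun x => x % 2 = 1) := by
      apply Finset.filter_congr; intro x _; omega
    rw [this] at hsplit
    omega
  have hcomm : ∑ x ∈ range (n-2), ((Icc 1 k).filter (fun j => L x ≤ j ∧ j ≤ L (x+1))).card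
      = ∑ j ∈ Icc 1 k, ((range (n-2)).filter (fun x => L x ≤ j ∧ j ≤ L (x+1))).card := by
    simp only [Finset.card_filter]
    exact Finset.sum_comm
  have hb : ∑ j ∈ Icc 1 k, ((range (n-2)).filter (fun x => L x ≤ j ∧ j ≤ L (x+1))).card
      ≤ ∑ j ∈ Icc 1 k, 2*k := Finset.sum_le_sum (fun j _ => hU j)
  rw [Finset.sum_const, Nat.card_Icc, smul_eq_mul] at hb
  have a1 := (hL 0 (by omega)).2.1
  have a2 := (hL (n-2) (by omega)).1
  have e : (k + 1 - 1) * (2*k) = 2*k^2 := by rw [Nat.add_sub_cancel]; ring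
  omega

theorem descend_all {n k ℓ : ℕ} (hk : IndepNumLE G k) (hk0 : 0 < k) (hℓ : 2*k^2 + k + 1 ≤ ℓ)
    (hn : ℓ ≤ n) (hc : HasCycleLength G n) : HasCycleLength G ℓ := by
  induction n, hn using Nat.le_induction with
  | base => exact hc
  | succ m hm ih =>
    apply ih
    have := descend hk hk0 (by omega) hc
    simpa using this

end Descend

section Core
variable {V : Type} {G : SimpleGraph V}

def Indep (G : SimpleGraph V) (s : Finset V) : Prop := ∀ x ∈ s, ∀ y ∈ s, x ≠ y → ¬ G.Adj x y

open Classical in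
noncomputable def aN (G : SimpleGraph V) (H : Finset V) : ℕ :=
  (H.powerset.filter (fun s => Indep G s)).sup Finset.card

theorem le_aN {H s : Finset V} (h : s ⊆ H) (hs : Indep G s) : s.card ≤ aN G H := by
  classical
  unfold aN
  apply Finset.le_sup (f := Finset.card)
  simp [h, hs]

theorem aN_spec (H : Finset V) : ∃ s ⊆ H, Indep G s ∧ s.card = aN G H := by
  classical
  have hne : (H.powerset.filter (fun s => Indep G s)).Nonempty := ⟨∅, by
    rw [Finset.mem_filter]
    exact ⟨by simp, fun x hx => by simp at hx⟩⟩
  obtain ⟨t, ht, hteq⟩ := Finset.exists_mem_eq_sup _ hne Finset.card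
  rw [Finset.mem_filter, Finset.mem_powerset] at ht
  exact ⟨t, ht.1, ht.2, by rw [aN, hteq]⟩

theorem Indep.union [DecidableEq V] {s t : Finset V} (hs : Indep G s) (ht : Indep G t)
    (hst : ∀ a ∈ s, ∀ b ∈ t, ¬ G.Adj a b) : Indep G (s ∪ t) := by
  intro x hx y hy hxy
  rw [Finset.mem_union] at hx hy
  rcases hx with hx | hx <;> rcases hy with hy | hy
  · exact hs x hx y hy hxy
  · exact hst x hx y hy
  · exact fun h => hst y hy x hx h.symm
  · exact ht x hx y hy hxy

theorem aN_add [DecidableEq V] {A B H : Finset V} (hA : A ⊆ H) (hB : B ⊆ H) (hd : Disjoint A B)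
    (hn : ∀ a ∈ A, ∀ b ∈ B, ¬ G.Adj a b) : aN G A + aN G B ≤ aN G H := by
  obtain ⟨s, hs, si, sc⟩ := aN_spec (G := G) A
  obtain ⟨t, ht, ti, tc⟩ := aN_spec (G := G) B
  rw [← sc, ← tc, ← Finset.card_union_of_disjoint (Finset.disjoint_of_subset_left hs
    (Finset.disjoint_of_subset_right ht hd))]
  apply le_aN (Finset.union_subset (hs.trans hA) (ht.trans hB))
  exact si.union ti (fun a ha b hb => hn a (hs ha) b (ht hb))

theorem exists_core [DecidableEq V] {k : ℕ} (hk0 : 0 < k) (hk : IndepNumLE G k) (X : Finset V)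
    (hX : 124 * k^2 ≤ X.card) : ∃ H ⊆ X, H.Nonempty ∧
    (∀ A B, A ⊆ H → B ⊆ H → A.Nonempty → B.Nonempty → Disjoint A B →
      (∀ a ∈ A, ∀ b ∈ B, ¬ G.Adj a b) → 4*k < (H \ (A ∪ B)).card) ∧
    (∀ I N, I ⊆ H → I.Nonempty → Indep G I → N ⊆ H → I ⊆ N →
      (∀ y ∈ I, ∀ x ∈ H, G.Adj y x → x ∈ N) → 120*k*I.card ≤ N.card) := by
  classical
  let P : Finset V → Prop := fun H => H.Nonempty ∧ 124*k*aN G H ≤ H.card + 4*k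
  have hPX : P X := by
    refine ⟨?_, ?_⟩
    · rw [← Finset.card_pos]
      have : 1 ≤ k^2 := Nat.one_le_pow _ _ hk0
      omega
    · obtain ⟨s, hs, si, sc⟩ := aN_spec (G := G) X
      have h1 : aN G X ≤ k := by rw [← sc]; exact hk s si
      nlinarith
  obtain ⟨H, hH, hmin⟩ := Finset.exists_min_image (X.powerset.filter P) Finset.card
    ⟨X, by simp [hPX]⟩
  rw [Finset.mem_filter, Finset.mem_powerset] at hH
  obtain ⟨hHX, hHne, hHc⟩ := hH
  have hmin' : ∀ A, A ⊆ H → A.Nonempty → A.card < H.card → A.card + 4*k < 124*k*aN G A := by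
    intro A hA hAne hlt
    by_contra hcon
    have := hmin A (by
      rw [Finset.mem_filter, Finset.mem_powerset]
      exact ⟨hA.trans hHX, hAne, by omega⟩)
    omega
  refine ⟨H, hHX, hHne, ?_, ?_⟩
  · intro A B hA hB hAne hBne hd hn
    by_contra hcon
    have h1 := aN_add hA hB hd hn
    have h2 : (A ∪ B).card + (H \ (A ∪ B)).card = H.card := by
      rw [add_comm]
      exact Finset.card_sdiff_add_card_eq_card (Finset.union_subset hA hB)
    rw [Finset.card_union_of_disjoint hd] at h2
    have hAB := Finset.card_le_card (Finset.union_subset hA hB)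
    rw [Finset.card_union_of_disjoint hd] at hAB
    have pA := hAne.card_pos
    have pB := hBne.card_pos
    have m1 := hmin' A hA hAne (by omega)
    have m2 := hmin' B hB hBne (by omega)
    have h3 : 124*k*(aN G A + aN G B) ≤ 124*k*aN G H := Nat.mul_le_mul_left _ h1
    rw [mul_add] at h3
    omega
  · intro I N hI hIne hIi hN hIN hadj
    have hc : (H \ N).card + N.card = H.card := Finset.card_sdiff_add_card_eq_card hN
    have pI := hIne.card_pos
    have hIle : I.card ≤ N.card := Finset.card_le_card hIN
    have e1 : 124*k*I.card = 120*k*I.card + 4*(k*I.card) := by ring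
    have e2 : k ≤ k*I.card := Nat.le_mul_of_pos_right _ pI
    rcases Finset.eq_empty_or_nonempty (H \ N) with he | hne
    · have h1 := le_aN (G := G) hI hIi
      have h3 : 124*k*I.card ≤ 124*k*aN G H := Nat.mul_le_mul_left _ h1
      rw [he, Finset.card_empty] at hc
      omega
    · have h1 := aN_add (G := G) (A := I) (B := H \ N) (H := H) hI Finset.sdiff_subset
        (by
          rw [Finset.disjoint_left]
          intro a ha ha'
          exact (Finset.mem_sdiff.1 ha').2 (hIN ha))
        (by
          intro a ha b hb hab
          rw [Finset.mem_sdiff] at hb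
          exact hb.2 (hadj a ha b hb.1 hab))
      have h2 := le_aN (G := G) (Finset.Subset.refl I) hIi
      have m1 := hmin' (H \ N) Finset.sdiff_subset hne (by omega)
      have h3 : 124*k*(I.card + aN G (H \ N)) ≤ 124*k*aN G H := Nat.mul_le_mul_left _ (by omega)
      rw [mul_add] at h3
      omega

end Core

section Gap
variable {V : Type} {G : SimpleGraph V}

theorem exists_edge {k : ℕ} (hk : IndepNumLE G k) {s : Finset V} (hs : k < s.card) :
    ∃ x ∈ s, ∃ y ∈ s, G.Adj x y := by
  by_contra hcon
  push Not at hcon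
  have := hk s (fun x hx y hy _ => hcon x hx y hy)
  omega

theorem IsP.uncons {a b : V} {l : List V} (h : IsP G a b l) (hab : a ≠ b) :
    ∃ c t, l = a :: t ∧ G.Adj a c ∧ IsP G c b t ∧ a ∉ t := by
  obtain ⟨t, rfl⟩ := h.eq_cons
  cases t with
  | nil =>
    have := h.2.2.2
    simp at this
    exact absurd this hab
  | cons c t =>
    obtain ⟨h1, h2, h3⟩ := h.tail
    exact ⟨c, c :: t, rfl, h1, h2, h3⟩

theorem IsP.suffix {a b c : V} {l1 l2 : List V} (h : IsP G a b (l1 ++ c :: l2)) :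
    IsP G c b (c :: l2) := by
  obtain ⟨n1, c1, s1, e1⟩ := h
  refine ⟨(List.nodup_append.1 n1).2.1, (List.isChain_append.1 c1).2.1, rfl, ?_⟩
  rw [List.getLast?_append] at e1
  rw [List.getLast?_cons] at e1 ⊢
  simpa using e1

theorem IsP.prefix {a b c : V} {l1 l2 : List V} (h : IsP G a b (l1 ++ c :: l2)) :
    IsP G a c (l1 ++ [c]) := by
  have h1 := h.rev
  simp only [List.reverse_append, List.reverse_cons, List.append_assoc, List.singleton_append] at h1
  have := h1.suffix.rev
  simpa using this

theorem shorten_step {k : ℕ} (hk : IndepNumLE G k) {a b : V} {l : List V} (h : IsP G a b l)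
    (hl : 2*k + 1 ≤ l.length) : ∃ l', IsP G a b l' ∧ (∀ x ∈ l', x ∈ l) ∧ l'.length < l.length ∧
      l.length < l'.length + 2*k := by
  classical
  obtain ⟨v, hinj, hadj, h0, hlast, hget⟩ := isP_to_fun h
  have hinj2 : Set.InjOn (fun i => v (2*i)) (range (k+1) : Set ℕ) := by
    intro i hi j hj hij
    simp at hi hj
    have := hinj (2*i) (2*j) (by omega) (by omega) hij
    omega
  obtain ⟨x, hx, y, hy, hxy⟩ := exists_edge hk (s := (range (k+1)).image (fun i => v (2*i)))
    (by rw [Finset.card_image_of_injOn hinj2]; simp)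
  rw [Finset.mem_image] at hx hy
  obtain ⟨i, hi, rfl⟩ := hx
  obtain ⟨j, hj, rfl⟩ := hy
  rw [Finset.mem_range] at hi hj
  have main : ∀ i j, i < j → j < k + 1 → G.Adj (v (2*i)) (v (2*j)) → ∃ l', IsP G a b l' ∧
      (∀ x ∈ l', x ∈ l) ∧ l'.length < l.length ∧ l.length < l'.length + 2*k := by
    intro i j hij hj hadj2
    have h1 : IsP G _ _ (seg v 0 (2*i+1)) := isP_seg (by omega)
      (fun p q _ h2 _ h4 => hinj p q (by omega) (by omega)) (fun p _ h2 => hadj p (by omega))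
    have h2 : IsP G _ _ (seg v (2*j) (l.length - 2*j)) := isP_seg (by omega)
      (fun p q _ h2 _ h4 => hinj p q (by omega) (by omega)) (fun p _ h2 => hadj p (by omega))
    have e1 : 0 + (2*i+1) - 1 = 2*i := by omega
    have e2 : 2*j + (l.length - 2*j) - 1 = l.length - 1 := by omega
    rw [e1, h0] at h1
    rw [e2, hlast] at h2
    refine ⟨_, h1.append h2 hadj2 ?_, ?_, ?_, ?_⟩
    · intro w hw hw'
      obtain ⟨p, a1, a2, a3⟩ := mem_seg.1 hw
      obtain ⟨q, b1, b2, b3⟩ := mem_seg.1 hw'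
      have := hinj p q (by omega) (by omega) (a3.trans b3.symm)
      omega
    · intro w hw
      rw [List.mem_append] at hw
      have : ∃ p, ∃ hp : p < l.length, v p = w := by
        rcases hw with hw | hw
        · obtain ⟨p, a1, a2, a3⟩ := mem_seg.1 hw
          exact ⟨p, by omega, a3⟩
        · obtain ⟨p, a1, a2, a3⟩ := mem_seg.1 hw
          exact ⟨p, by omega, a3⟩
      obtain ⟨p, hp, rfl⟩ := this
      rw [hget p hp]
      exact List.getElem_mem hp
    · rw [List.length_append, seg_length, seg_length]; omega
    · rw [List.length_append, seg_length, seg_length]; omega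
  have hne : i ≠ j := by rintro rfl; exact G.loopless.irrefl _ hxy
  rcases Nat.lt_or_gt_of_ne hne with h3 | h3
  · exact main i j h3 hj hxy
  · exact main j i h3 hi hxy.symm

theorem shorten {k : ℕ} (hk : IndepNumLE G k) (N : ℕ) (hN : 2*k ≤ N) {a b : V} : ∀ (m : ℕ)
    (l : List V), l.length = m → IsP G a b l → N < l.length + 2*k →
    ∃ l', IsP G a b l' ∧ (∀ x ∈ l', x ∈ l) ∧ l'.length ≤ N ∧ N < l'.length + 2*k := by
  intro m
  induction m using Nat.strong_induction_on with
  | _ m ih =>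
    intro l hlm h hl
    rcases Nat.lt_or_ge N l.length with h1 | h1
    · obtain ⟨l1, a1, a2, a3, a4⟩ := shorten_step hk h (by omega)
      obtain ⟨l2, b1, b2, b3, b4⟩ := ih l1.length (by omega) l1 rfl a1 (by omega)
      exact ⟨l2, b1, fun x hx => a2 x (b2 x hx), b3, b4⟩
    · exact ⟨l, h, fun x hx => hx, h1, hl⟩

theorem tri_chain [DecidableEq V] {k : ℕ} (hk0 : 0 < k) (hk : IndepNumLE G k) {H : Finset V}
    (hdeg : ∀ a ∈ H, ∀ N : Finset V, a ∈ N → (∀ x ∈ H, G.Adj a x → x ∈ N) → 120*k ≤ N.card)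
    {q1 q2 : V} (hq1 : q1 ∈ H) (hq : q1 ≠ q2) : ∀ t, t ≤ 2*k → ∃ a U, U ⊆ H ∧
      U.card ≤ 2*t+1 ∧ q1 ∈ U ∧ a ∈ U ∧ q2 ∉ U ∧ ∀ M, t + 1 ≤ M → M ≤ 2*t+1 →
        ∃ l, IsP G q1 a l ∧ (∀ x ∈ l, x ∈ U) ∧ l.length = M := by
  classical
  intro t
  induction t with
  | zero =>
    intro _
    refine ⟨q1, {q1}, by simpa using hq1, by simp, by simp, by simp, by simpa using hq.symm, ?_⟩
    intro M h1 h2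
    refine ⟨[q1], IsP.single _, by simp, by simp; omega⟩
  | succ t ih =>
    intro ht
    obtain ⟨a, U, hUH, hUc, h1U, haU, h2U, hpath⟩ := ih (by omega)
    have h1 := hdeg a (hUH haU) ((H.filter (fun x => G.Adj a x) \ insert q2 U) ∪ insert q2 U)
      (by simp [haU]) (by
        intro x hx hax
        rw [Finset.mem_union, Finset.mem_sdiff, Finset.mem_filter]
        by_cases hxU : x ∈ insert q2 U
        · exact Or.inr hxU
        · exact Or.inl ⟨⟨hx, hax⟩, hxU⟩)
    have h2 := Finset.card_union_le (H.filter (fun x => G.Adj a x) \ insert q2 U) (insert q2 U)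
    have h3 := Finset.card_insert_le q2 U
    obtain ⟨b, hb, c, hc, hbc⟩ := exists_edge hk
      (s := H.filter (fun x => G.Adj a x) \ insert q2 U) (by omega)
    simp only [Finset.mem_sdiff, Finset.mem_filter, Finset.mem_insert, not_or] at hb hc
    refine ⟨c, insert b (insert c U), ?_, ?_, ?_, ?_, ?_, ?_⟩
    · exact Finset.insert_subset hb.1.1 (Finset.insert_subset hc.1.1 hUH)
    · have e1 := Finset.card_insert_le b (insert c U)
      have e2 := Finset.card_insert_le c U
      omega
    · simp [h1U]
    · simp
    · simp only [Finset.mem_insert, not_or]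
      exact ⟨fun h => hb.2.1 h.symm, fun h => hc.2.1 h.symm, h2U⟩
    · intro M hM1 hM2
      rcases Nat.lt_or_ge M (2*t+3) with hM | hM
      · obtain ⟨l, hl, hlU, hlen⟩ := hpath (M-1) (by omega) (by omega)
        refine ⟨l ++ [c], hl.append (IsP.single c) hc.1.2 ?_, ?_, ?_⟩
        · intro x hx hx'
          simp at hx'
          subst hx'
          exact hc.2.2 (hlU _ hx)
        · intro x hx
          simp at hx
          rcases hx with hx | hx
          · simp [hlU x hx]
          · simp [hx]
        · simp; omega
      · obtain ⟨l, hl, hlU, hlen⟩ := hpath (2*t+1) (by omega) (by omega)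
        have h4 := (IsP.single b).append (IsP.single c) hbc (by
          intro x hx hx'
          simp at hx hx'
          subst hx; subst hx'
          exact G.loopless.irrefl _ hbc)
        refine ⟨l ++ ([b] ++ [c]), hl.append h4 hb.1.2 ?_, ?_, ?_⟩
        · intro x hx hx'
          simp at hx'
          rcases hx' with hx' | hx'
          · subst hx'
            exact hb.2.2 (hlU _ hx)
          · subst hx'
            exact hc.2.2 (hlU _ hx)
        · intro x hx
          simp at hx
          rcases hx with hx | hx | hx
          · simp [hlU x hx]
          · simp [hx]
          · simp [hx]
        · simp; omega

theorem IsP.sub {a b y : V} {l : List V} (h : IsP G a b l) (hy : y ∈ l) :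
    ∃ l', IsP G a y l' ∧ ∀ x ∈ l', x ∈ l := by
  obtain ⟨l1, l2, rfl⟩ := List.append_of_mem hy
  refine ⟨_, h.prefix, ?_⟩
  intro x hx
  simp at hx ⊢
  tauto

theorem conn_path [DecidableEq V] {H Y : Finset V} {m : ℕ}
    (hconn : ∀ A B, A ⊆ H → B ⊆ H → A.Nonempty → B.Nonempty → Disjoint A B →
      (∀ a ∈ A, ∀ b ∈ B, ¬ G.Adj a b) → m < (H \ (A ∪ B)).card)
    (hY : Y ⊆ H) (hYc : (H \ Y).card ≤ m) {a b : V} (ha : a ∈ Y) (hb : b ∈ Y) :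
    ∃ l, IsP G a b l ∧ ∀ x ∈ l, x ∈ Y := by
  classical
  by_contra hcon
  let A := Y.filter (fun y => ∃ l, IsP G a y l ∧ ∀ x ∈ l, x ∈ Y)
  have hAY : A ⊆ Y := Finset.filter_subset _ _
  have hm := hconn A (Y \ A) (hAY.trans hY) (Finset.sdiff_subset.trans hY)
    ⟨a, Finset.mem_filter.2 ⟨ha, [a], IsP.single a, by simpa using ha⟩⟩
    ⟨b, by
      rw [Finset.mem_sdiff]
      refine ⟨hb, fun h => hcon (Finset.mem_filter.1 h).2⟩⟩
    Finset.disjoint_sdiff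
    (by
      intro x hx y hy hxy
      rw [Finset.mem_sdiff] at hy
      obtain ⟨hxY, l, hl, hlY⟩ := Finset.mem_filter.1 hx
      apply hy.2
      refine Finset.mem_filter.2 ⟨hy.1, ?_⟩
      by_cases hyl : y ∈ l
      · obtain ⟨l', h1, h2⟩ := hl.sub hyl
        exact ⟨l', h1, fun z hz => hlY z (h2 z hz)⟩
      · refine ⟨l ++ [y], hl.append (IsP.single y) hxy ?_, ?_⟩
        · intro z hz hz'
          simp at hz'
          subst hz'
          exact hyl hz
        · intro z hz
          simp at hz
          rcases hz with hz | hz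
          · exact hlY z hz
          · rw [hz]; exact hy.1)
  rw [Finset.union_sdiff_of_subset hAY] at hm
  omega

theorem inner_path [DecidableEq V] {k : ℕ} (hk0 : 0 < k) (hk : IndepNumLE G k) {H : Finset V}
    (hconn : ∀ A B, A ⊆ H → B ⊆ H → A.Nonempty → B.Nonempty → Disjoint A B →
      (∀ a ∈ A, ∀ b ∈ B, ¬ G.Adj a b) → 4*k < (H \ (A ∪ B)).card)
    (hdeg : ∀ a ∈ H, ∀ N : Finset V, a ∈ N → (∀ x ∈ H, G.Adj a x → x ∈ N) → 120*k ≤ N.card)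
    {q1 q2 : V} (hq1 : q1 ∈ H) (hq2 : q2 ∈ H) (hq : q1 ≠ q2) :
    ∃ s, s ≤ 4*k+1 ∧ ∀ M, s ≤ M → M ≤ s + 2*k →
      ∃ l, IsP G q1 q2 l ∧ (∀ x ∈ l, x ∈ H) ∧ l.length = M := by
  obtain ⟨a, U, hUH, hUc, h1U, haU, h2U, hpath⟩ := tri_chain hk0 hk hdeg hq1 hq (2*k) le_rfl
  have haq : a ≠ q2 := by rintro rfl; exact h2U haU
  obtain ⟨w0, hw0, hw0Y⟩ := conn_path (Y := H \ U.erase a) (a := a) (b := q2) hconn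
    Finset.sdiff_subset (by
      have h1 : H \ (H \ U.erase a) ⊆ U.erase a := by
        intro x hx
        simp only [Finset.mem_sdiff] at hx
        by_contra h
        exact hx.2 ⟨hx.1, h⟩
      have h2 := Finset.card_le_card h1
      rw [Finset.card_erase_of_mem haU] at h2
      omega)
    (by simp [hUH haU]) (by simp [hq2, h2U])
  have : ∃ w, IsP G a q2 w ∧ (∀ x ∈ w, x ∈ H \ U.erase a) ∧ w.length ≤ 2*k+1 := by
    rcases Nat.lt_or_ge w0.length (2*k+1) with h | h
    · exact ⟨w0, hw0, hw0Y, by omega⟩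
    · obtain ⟨w, b1, b2, b3, b4⟩ := shorten hk (2*k+1) (by omega) _ w0 rfl hw0 (by omega)
      exact ⟨w, b1, fun x hx => hw0Y x (b2 x hx), b3⟩
  obtain ⟨w, hw, hwY, hwl⟩ := this
  obtain ⟨c, t, rfl, hac, ht, hat⟩ := hw.uncons haq
  rw [List.length_cons] at hwl
  refine ⟨2*k + 1 + t.length, by omega, ?_⟩
  intro M hM1 hM2
  obtain ⟨l, hl, hlU, hlen⟩ := hpath (M - t.length) (by omega) (by omega)
  refine ⟨l ++ t, hl.append ht hac ?_, ?_, ?_⟩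
  · intro x hx hx'
    have h1 := hlU x hx
    have h2 := hwY x (List.mem_cons_of_mem _ hx')
    rw [Finset.mem_sdiff, Finset.mem_erase] at h2
    exact h2.2 ⟨by rintro rfl; exact hat hx', h1⟩
  · intro x hx
    rw [List.mem_append] at hx
    rcases hx with hx | hx
    · exact hUH (hlU x hx)
    · exact (Finset.mem_sdiff.1 (hwY x (List.mem_cons_of_mem _ hx))).1
  · rw [List.length_append]; omega

theorem first_hit (p : V → Prop) : ∀ l : List V, (∃ x ∈ l, p x) →
    ∃ A q R, l = A ++ q :: R ∧ p q ∧ ∀ x ∈ A, ¬ p x := by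
  classical
  intro l
  induction l with
  | nil => rintro ⟨x, hx, -⟩; simp at hx
  | cons y t ih =>
    rintro ⟨x, hx, hpx⟩
    by_cases hy : p y
    · exact ⟨[], y, t, rfl, hy, by simp⟩
    · rw [List.mem_cons] at hx
      rcases hx with rfl | hx
      · exact absurd hpx hy
      · obtain ⟨A, q, R, rfl, hq, hA⟩ := ih ⟨x, hx, hpx⟩
        refine ⟨y :: A, q, R, rfl, hq, ?_⟩
        intro z hz
        rw [List.mem_cons] at hz
        rcases hz with rfl | hz
        · exact hy
        · exact hA z hz

theorem last_hit (p : V → Prop) (l : List V) (h : ∃ x ∈ l, p x) :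
    ∃ A q R, l = A ++ q :: R ∧ p q ∧ ∀ x ∈ R, ¬ p x := by
  obtain ⟨A, q, R, h1, h2, h3⟩ := first_hit p l.reverse (by simpa using h)
  refine ⟨R.reverse, q, A.reverse, ?_, h2, ?_⟩
  · rw [← List.reverse_reverse l, h1]; simp
  · intro x hx; exact h3 x (by simpa using hx)

theorem gap_fill [DecidableEq V] {k ℓ : ℕ} (hk0 : 0 < k) (hk : IndepNumLE G k) {H : Finset V}
    (hconn : ∀ A B, A ⊆ H → B ⊆ H → A.Nonempty → B.Nonempty → Disjoint A B →
      (∀ a ∈ A, ∀ b ∈ B, ¬ G.Adj a b) → 4*k < (H \ (A ∪ B)).card)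
    (hdeg : ∀ a ∈ H, ∀ N : Finset V, a ∈ N → (∀ x ∈ H, G.Adj a x → x ∈ N) → 120*k ≤ N.card)
    (hH2 : 2 ≤ H.card) {a b : V} {I O : List V} (hc : IsP G a b (I ++ O)) (hba : G.Adj b a)
    (hHI : ∀ x ∈ H, x ∈ I) (hO : 4*k^2 ≤ O.length)
    (hℓ1 : 6*k ≤ ℓ) (hℓ2 : ℓ ≤ 2*k^2+k+1) : HasCycleLength G ℓ := by
  have hHne : H.Nonempty := by rw [← Finset.card_pos]; omega
  obtain ⟨A, q1, R, rfl, hq1, hA⟩ := first_hit (fun x => x ∈ H) I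
    (by obtain ⟨x, hx⟩ := hHne; exact ⟨x, hHI x hx, hx⟩)
  have hR : ∃ x ∈ R, x ∈ H := by
    have : (H.erase q1).Nonempty := by
      rw [← Finset.card_pos, Finset.card_erase_of_mem hq1]; omega
    obtain ⟨x, hx⟩ := this
    rw [Finset.mem_erase] at hx
    have := hHI x hx.2
    rw [List.mem_append, List.mem_cons] at this
    rcases this with h | h | h
    · exact absurd hx.2 (hA x h)
    · exact absurd h hx.1
    · exact ⟨x, h, hx.2⟩
  obtain ⟨B, q2, A', rfl, hq2, hA'⟩ := last_hit (fun x => x ∈ H) R hR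
  have e1 : A ++ q1 :: (B ++ q2 :: A') ++ O = (A ++ q1 :: B) ++ q2 :: (A' ++ O) := by simp
  have e2 : A ++ q1 :: (B ++ q2 :: A') ++ O = A ++ q1 :: (B ++ q2 :: A' ++ O) := by simp
  have hnd := hc.1
  have p1 : IsP G q2 b (q2 :: (A' ++ O)) := by rw [e1] at hc; exact hc.suffix
  have p2 : IsP G a q1 (A ++ [q1]) := by rw [e2] at hc; exact hc.prefix
  have hOH : ∀ x ∈ O, x ∉ H := by
    intro x hx hxH
    exact (List.nodup_append.1 hnd).2.2 x (hHI x hxH) x hx rfl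
  have hdis : ∀ x ∈ q2 :: (A' ++ O), x ∉ A ++ [q1] := by
    intro x hx hx'
    have e3 : A ++ q1 :: (B ++ q2 :: A') ++ O = (A ++ [q1]) ++ (B ++ q2 :: (A' ++ O)) := by simp
    rw [e3] at hnd
    exact (List.nodup_append.1 hnd).2.2 x hx' x (List.mem_append_right _ hx) rfl
  have hq : q1 ≠ q2 := by
    rintro rfl
    exact hdis q1 (by simp) (by simp)
  have hout := p1.append p2 hba hdis
  have houtH : ∀ x ∈ q2 :: (A' ++ O) ++ (A ++ [q1]), x ∈ H → x = q1 ∨ x = q2 := by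
    intro x hx hxH
    simp only [List.mem_append, List.mem_cons, List.not_mem_nil, or_false] at hx
    rcases hx with (h | h | h) | h | h
    · exact Or.inr h
    · exact absurd hxH (hA' x h)
    · exact absurd hxH (hOH x h)
    · exact absurd hxH (hA x h)
    · exact Or.inl h
  obtain ⟨s, hs, hin⟩ := inner_path hk0 hk hconn hdeg hq1 hq2 hq
  have hk2 : 1 ≤ k^2 := Nat.one_le_pow _ _ hk0
  obtain ⟨w, w1, w2, w3, w4⟩ := shorten hk (ℓ + 2 - s) (by omega) _ _ rfl hout (by
    simp only [List.length_append, List.length_cons, List.length_nil]; omega)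
  obtain ⟨z, z1, z2, z3⟩ := hin (ℓ + 2 - w.length) (by omega) (by omega)
  obtain ⟨c, t, rfl, hc1, ht, hqt⟩ := w1.uncons hq.symm
  obtain ⟨d, u, rfl, hd1, hu, hqu⟩ := z1.uncons hq
  have hfin := ht.append hu hd1 (by
    intro x hx hx'
    have h1 := z2 x (List.mem_cons_of_mem _ hx')
    rcases houtH x (w2 x (List.mem_cons_of_mem _ hx)) h1 with rfl | rfl
    · exact hqu hx'
    · exact hqt hx)
  simp only [List.length_cons] at z3 w3 w4
  have hlen : (t ++ u).length = ℓ := by rw [List.length_append]; omega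
  have := hfin.close hc1 (by omega)
  rw [hlen] at this
  exact this

end Gap

section Short
variable {V : Type} {G : SimpleGraph V}

def Lev (G : SimpleGraph V) (i : ℕ) (U L : Finset V) (rk : V → ℕ) (d : V → V → ℕ) : Prop :=
  Disjoint U L ∧ (∀ x ∈ L, ∀ y ∈ L, rk x = rk y → x = y) ∧
  (∀ x ∈ L, ∀ y ∈ L, ∀ z ∈ L, rk x ≤ rk y → rk y ≤ rk z → d x z = max (d x y) (d y z)) ∧
  (∀ x ∈ L, d x x = 0) ∧
  (∀ x ∈ L, ∀ y ∈ L, rk x < rk y → 1 ≤ d x y ∧ d x y ≤ i ∧ ∃ W c e, IsP G c e W ∧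
    G.Adj x c ∧ G.Adj e y ∧ (∀ w ∈ W, w ∈ U) ∧ W.length + 1 = 2 * d x y)

theorem lev_zero (v : V) : Lev G 0 ∅ {v} (fun _ => 0) (fun _ _ => 0) := by
  refine ⟨by simp, ?_, ?_, ?_, ?_⟩
  · intro x hx y hy _
    simp at hx hy
    rw [hx, hy]
  · intros; rfl
  · intros; rfl
  · intro x hx y hy h
    exact absurd h (lt_irrefl _)

theorem lev_succ [Fintype V] [DecidableEq V] {i : ℕ} {U L L' : Finset V} {rk : V → ℕ}
    {d : V → V → ℕ} (h : Lev G i U L rk d) (hd : Disjoint (U ∪ L) L')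
    (hpar : ∀ u ∈ L', ∃ p ∈ L, G.Adj p u) : ∃ rk' d', Lev G (i+1) (U ∪ L) L' rk' d' := by
  classical
  obtain ⟨h0, hinj, hmax, hdiag, hpath⟩ := h
  choose! π hπL hπadj using hpar
  let e : V → ℕ := fun u => (Fintype.equivFin V u).val
  have he : ∀ u, e u < Fintype.card V := fun u => (Fintype.equivFin V u).isLt
  have heinj : ∀ u w, e u = e w → u = w := by
    intro u w huw
    exact (Fintype.equivFin V).injective (Fin.ext huw)
  let N := Fintype.card V
  let rk' : V → ℕ := fun u => N * rk (π u) + e u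
  let d' : V → V → ℕ := fun x y => if x = y then 0 else d (π x) (π y) + 1
  have hle : ∀ x y, rk' x ≤ rk' y → rk (π x) ≤ rk (π y) := by
    intro x y hxy
    by_contra hcon
    have h1 : rk (π y) + 1 ≤ rk (π x) := by omega
    have h2 : N * (rk (π y) + 1) ≤ N * rk (π x) := Nat.mul_le_mul_left _ h1
    have h3 := he y
    have h4 : N * rk (π x) + e x ≤ N * rk (π y) + e y := hxy
    rw [mul_add] at h2
    have : N = Fintype.card V := rfl
    omega
  have hinj' : ∀ x ∈ L', ∀ y ∈ L', rk' x = rk' y → x = y := by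
    intro x hx y hy hxy
    have h1 := hle x y hxy.le
    have h2 := hle y x hxy.ge
    have h3 : rk (π x) = rk (π y) := by omega
    have h4 : N * rk (π x) + e x = N * rk (π y) + e y := hxy
    rw [h3] at h4
    exact heinj x y (by omega)
  refine ⟨rk', d', hd, hinj', ?_, ?_, ?_⟩
  · intro x hx y hy z hz hxy hyz
    by_cases h1 : x = y
    · subst h1
      simp [d']
    by_cases h2 : y = z
    · subst h2
      simp [d']
    have h3 : x ≠ z := by
      rintro rfl
      exact h1 (hinj' x hx y hy (by omega))
    simp only [d', h1, h2, h3, if_false]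
    rw [hmax (π x) (hπL x hx) (π y) (hπL y hy) (π z) (hπL z hz) (hle _ _ hxy) (hle _ _ hyz)]
    omega
  · intro x hx; simp [d']
  · intro x hx y hy hxy
    have hne : x ≠ y := by rintro rfl; exact lt_irrefl _ hxy
    have hd' : d' x y = d (π x) (π y) + 1 := by simp only [d', hne, if_false]
    rw [hd']
    by_cases hp : π x = π y
    · refine ⟨by omega, ?_, [π x], π x, π x, IsP.single _, (hπadj x hx).symm, ?_, ?_, ?_⟩
      · rw [← hp, hdiag _ (hπL x hx)]; omega
      · rw [hp]; exact hπadj y hy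
      · intro w hw
        simp at hw
        rw [hw]
        exact Finset.mem_union_right _ (hπL x hx)
      · rw [← hp, hdiag _ (hπL x hx)]; rfl
    · have hlt : rk (π x) < rk (π y) := by
        have h1 := hle x y hxy.le
        have h2 : rk (π x) ≠ rk (π y) := fun h => hp (hinj _ (hπL x hx) _ (hπL y hy) h)
        omega
      obtain ⟨g1, g2, W, c, f, hW, hc, hf, hWU, hWl⟩ := hpath _ (hπL x hx) _ (hπL y hy) hlt
      have hnot : ∀ w ∈ L, w ∉ W := by
        intro w hw hw'
        exact (Finset.disjoint_left.1 h0) (hWU w hw') hw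
      have q1 := hW.append (IsP.single (π y)) hf (by
        intro w hw hw'
        simp at hw'
        subst hw'
        exact hnot _ (hπL y hy) hw)
      have q2 := (IsP.single (π x)).append q1 hc (by
        intro w hw hw'
        simp at hw
        subst hw
        rw [List.mem_append] at hw'
        rcases hw' with hw' | hw'
        · exact hnot _ (hπL x hx) hw'
        · simp at hw'; exact hp hw')
      refine ⟨by omega, by omega, _, _, _, q2, (hπadj x hx).symm, hπadj y hy, ?_, ?_⟩
      · intro w hw
        simp only [List.mem_append, List.mem_singleton] at hw
        rcases hw with hw | hw | hw
        · rw [hw]; exact Finset.mem_union_right _ (hπL x hx)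
        · exact Finset.mem_union_left _ (hWU w hw)
        · rw [hw]; exact Finset.mem_union_right _ (hπL y hy)
      · simp only [List.length_append, List.length_cons, List.length_nil]; omega

/-- increasing path with `m` edges in `L` -/
def IncP (G : SimpleGraph V) (L : Finset V) (rk : V → ℕ) (m : ℕ) (f : ℕ → V) : Prop :=
  (∀ i, i ≤ m → f i ∈ L) ∧ ∀ i, i < m → rk (f i) < rk (f (i+1)) ∧ G.Adj (f i) (f (i+1))

theorem IncP.mono {L : Finset V} {rk : V → ℕ} {m : ℕ} {f : ℕ → V} (h : IncP G L rk m f) :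
    ∀ b a, a < b → b ≤ m → rk (f a) < rk (f b) := by
  intro b
  induction b with
  | zero => intro a ha; omega
  | succ b ih =>
    intro a hab hb
    have h1 := (h.2 b (by omega)).1
    rcases Nat.lt_or_ge a b with h2 | h2
    · exact (ih a h2 (by omega)).trans h1
    · have : a = b := by omega
      subst this
      exact h1

theorem lev_cycle {i r : ℕ} {U L : Finset V} {rk : V → ℕ} {d : V → V → ℕ}
    (h : Lev G i U L rk d) (hi : 2*i ≤ r + 1) (hr : 1 ≤ r) {f : ℕ → V} (hf : IncP G L rk r f) :
    HasCycleLength G (r+2) := by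
  obtain ⟨h0, hinj, hmax, hdiag, hpath⟩ := h
  have hmono := hf.mono
  have hmono' : ∀ a b, a ≤ b → b ≤ r → rk (f a) ≤ rk (f b) := by
    intro a b hab hb
    rcases Nat.lt_or_ge a b with h2 | h2
    · exact (hmono b a h2 hb).le
    · have : a = b := by omega
      subst this; exact le_rfl
  obtain ⟨j, hj, hjmax⟩ := Finset.exists_max_image (range r) (fun j => d (f j) (f (j+1)))
    ⟨0, by simp; omega⟩
  rw [Finset.mem_range] at hj
  set hh := d (f j) (f (j+1)) with hhdef
  have hub : ∀ a b, a ≤ b → b ≤ r → d (f a) (f b) ≤ hh := by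
    intro a b hab
    induction b, hab using Nat.le_induction with
    | base => intro ha; rw [hdiag _ (hf.1 a ha)]; omega
    | succ b hb ih =>
      intro hbr
      rw [hmax (f a) (hf.1 a (by omega)) (f b) (hf.1 b (by omega)) (f (b+1)) (hf.1 _ hbr)
        (hmono' _ _ hb (by omega)) (hmono' _ _ (by omega) hbr)]
      have := hjmax b (by rw [Finset.mem_range]; omega)
      exact max_le (ih (by omega)) this
  have hlb : ∀ a b, a ≤ j → j + 1 ≤ b → b ≤ r → hh ≤ d (f a) (f b) := by
    intro a b ha hb hbr
    rw [hmax (f a) (hf.1 a (by omega)) (f j) (hf.1 j (by omega)) (f b) (hf.1 _ hbr)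
        (hmono' _ _ ha (by omega)) (hmono' _ _ (by omega) hbr)]
    rw [hmax (f j) (hf.1 j (by omega)) (f (j+1)) (hf.1 _ (by omega)) (f b) (hf.1 _ hbr)
        (hmono' _ _ (by omega) (by omega)) (hmono' _ _ (by omega) hbr)]
    exact le_max_of_le_right (le_max_left _ _)
  have hh1 := hpath (f j) (hf.1 j (by omega)) (f (j+1)) (hf.1 _ (by omega)) (hf.2 j hj).1
  obtain ⟨g1, g2, -⟩ := hh1
  have hp : ∃ p δ, δ + 2*hh = r + 2 ∧ 1 ≤ δ ∧ p ≤ j ∧ j + 1 ≤ p + δ ∧ p + δ ≤ r := by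
    refine ⟨j + 1 - (r + 2 - 2*hh), r + 2 - 2*hh, by omega, by omega, by omega, by omega, by omega⟩
  obtain ⟨p, δ, k1, k2, k3, k4, k5⟩ := hp
  have hdp : d (f p) (f (p+δ)) = hh :=
    le_antisymm (hub _ _ (by omega) k5) (hlb _ _ k3 k4 k5)
  obtain ⟨-, -, W, c, e, hW, hc, he, hWU, hWl⟩ := hpath (f p) (hf.1 p (by omega)) (f (p+δ))
    (hf.1 _ k5) (hmono _ _ (by omega) k5)
  have hs : IsP G _ _ (seg f p (δ+1)) := isP_seg (by omega) (by
      intro a b h1 h2 h3 h4 hab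
      rcases Nat.lt_trichotomy a b with h5 | h5 | h5
      · have := hmono b a h5 (by omega)
        rw [hab] at this; omega
      · exact h5
      · have := hmono a b h5 (by omega)
        rw [hab] at this; omega)
    (fun a h1 h2 => (hf.2 a (by omega)).2)
  have e1 : p + (δ+1) - 1 = p + δ := by omega
  rw [e1] at hs
  have hfin := hs.append hW.rev he.symm (by
    intro w hw hw'
    rw [List.mem_reverse] at hw'
    obtain ⟨a, a1, a2, rfl⟩ := mem_seg.1 hw
    exact (Finset.disjoint_left.1 h0) (hWU _ hw') (hf.1 a (by omega)))
  have hlen : (seg f p (δ+1) ++ W.reverse).length = r + 2 := by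
    rw [List.length_append, List.length_reverse, seg_length]; omega
  have := hfin.close hc.symm (by omega)
  rw [hlen] at this
  exact this

theorem lev_indep {i r : ℕ} {U L : Finset V} {rk : V → ℕ} {d : V → V → ℕ}
    (h : Lev G i U L rk d) (hi : 2*i ≤ r + 1) (hr : 1 ≤ r) (hno : ¬ HasCycleLength G (r+2)) :
    ∃ I ⊆ L, Indep G I ∧ L.card ≤ r * I.card := by
  classical
  let Q : V → ℕ → Prop := fun x m => ∃ f, IncP G L rk m f ∧ f m = x
  have hQr : ∀ x, ¬ Q x r := fun x ⟨f, hf, _⟩ => hno (lev_cycle h hi hr hf)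
  have hQ0 : ∀ x ∈ L, Q x 0 := fun x hx => ⟨fun _ => x, ⟨fun _ _ => hx, fun i hi => by omega⟩, rfl⟩
  have hQs : ∀ x y m, Q x m → y ∈ L → rk x < rk y → G.Adj x y → Q y (m+1) := by
    rintro x y m ⟨f, hf, rfl⟩ hy hxy hadj
    refine ⟨fun i => if i ≤ m then f i else y, ⟨?_, ?_⟩, ?_⟩
    · intro i hi
      by_cases him : i ≤ m
      · simp only [him, if_true]; exact hf.1 i him
      · simp only [him, if_false]; exact hy
    · intro i hi
      rcases Nat.lt_or_ge i m with him | him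
      · have h1 : i ≤ m := by omega
        have h2 : i + 1 ≤ m := by omega
        simp only [h1, h2, if_true]
        exact hf.2 i him
      · have : i = m := by omega
        subst this
        have h2 : ¬ (i + 1 ≤ i) := by omega
        simp only [h2, le_refl, if_true, if_false]
        exact ⟨hxy, hadj⟩
    · have h2 : ¬ (m + 1 ≤ m) := by omega
      simp only [h2, if_false]
  let col : V → ℕ := fun x => Nat.findGreatest (Q x) r
  have hcolQ : ∀ x ∈ L, Q x (col x) := fun x hx =>
    Nat.findGreatest_spec (P := Q x) (Nat.zero_le r) (hQ0 x hx)
  have hcol : ∀ x ∈ L, col x < r := by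
    intro x hx
    have h1 : col x ≤ r := Nat.findGreatest_le r
    rcases Nat.lt_or_ge (col x) r with h2 | h2
    · exact h2
    · have h3 := hcolQ x hx
      have h4 : col x = r := by omega
      rw [h4] at h3
      exact absurd h3 (hQr x)
  have hstep : ∀ x ∈ L, ∀ y ∈ L, rk x < rk y → G.Adj x y → col x < col y := by
    intro x hx y hy hxy hadj
    have h1 := hQs x y _ (hcolQ x hx) hy hxy hadj
    have h2 : col x + 1 ≤ col y := Nat.le_findGreatest (by have := hcol x hx; omega) h1
    omega
  obtain ⟨m, hm, hmmax⟩ := Finset.exists_max_image (range r)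
    (fun m => (L.filter (fun x => col x = m)).card) ⟨0, by simp; omega⟩
  refine ⟨L.filter (fun x => col x = m), Finset.filter_subset _ _, ?_, ?_⟩
  · intro x hx y hy hxy hadj
    rw [Finset.mem_filter] at hx hy
    have hne : rk x ≠ rk y := fun hh => hxy (h.2.1 x hx.1 y hy.1 hh)
    rcases Nat.lt_or_gt_of_ne hne with h1 | h1
    · have := hstep x hx.1 y hy.1 h1 hadj; omega
    · have := hstep y hy.1 x hx.1 h1 hadj.symm; omega
  · have := Finset.card_le_mul_card_image_of_maps_to (s := L) (t := range r) (f := col)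
      (fun x hx => by simpa using hcol x hx) _ hmmax
    rw [Finset.card_range, mul_comm] at this
    exact this

theorem lev_grow [Fintype V] [DecidableEq V] {H : Finset V} {E r q : ℕ}
    (hE : ∀ I N, I ⊆ H → I.Nonempty → Indep G I → N ⊆ H → I ⊆ N →
      (∀ y ∈ I, ∀ x ∈ H, G.Adj y x → x ∈ N) → E * I.card ≤ N.card)
    (hHne : H.Nonempty) (hr : 1 ≤ r) (hq : 2 ≤ q) (hEq : r * (q + 2) ≤ E)
    (hno : ¬ HasCycleLength G (r+2)) : ∀ i, 2*i ≤ r + 1 → ∃ U L rk d, Lev G (i+1) U L rk d ∧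
      U ⊆ H ∧ L ⊆ H ∧ U.card ≤ L.card ∧ r * q^(i+1) ≤ L.card := by
  classical
  have step : ∀ i U L rk d, 2*i ≤ r+1 → Lev G i U L rk d → U ⊆ H → L ⊆ H → 1 ≤ L.card →
      ∃ L' rk' d', Lev G (i+1) (U ∪ L) L' rk' d' ∧ L' ⊆ H ∧ ∃ m, L.card ≤ r * m ∧ 1 ≤ m ∧
        E * m ≤ U.card + L.card + L'.card := by
    intro i U L rk d hi hl hU hL hpos
    let L' := (H.filter (fun x => ∃ y ∈ L, G.Adj y x)) \ (U ∪ L)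
    have hL'H : L' ⊆ H := Finset.sdiff_subset.trans (Finset.filter_subset _ _)
    obtain ⟨I, hIL, hIi, hIc⟩ := lev_indep hl hi hr hno
    have hIpos : 1 ≤ I.card := by
      rcases Nat.eq_zero_or_pos I.card with h | h
      · rw [h] at hIc; omega
      · exact h
    obtain ⟨rk', d', hl'⟩ := lev_succ (L' := L') hl Finset.disjoint_sdiff (by
      intro u hu
      have := (Finset.mem_filter.1 (Finset.mem_sdiff.1 hu).1).2
      exact this)
    refine ⟨L', rk', d', hl', hL'H, I.card, hIc, hIpos, ?_⟩
    have h1 := hE I (U ∪ L ∪ L') (hIL.trans hL) (Finset.card_pos.1 hIpos) hIi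
      (Finset.union_subset (Finset.union_subset hU hL) hL'H)
      (hIL.trans (Finset.subset_union_right.trans Finset.subset_union_left))
      (by
        intro y hy x hx hadj
        by_cases hxU : x ∈ U ∪ L
        · exact Finset.mem_union_left _ hxU
        · exact Finset.mem_union_right _ (Finset.mem_sdiff.2
            ⟨Finset.mem_filter.2 ⟨hx, y, hIL hy, hadj⟩, hxU⟩))
    have h2 := Finset.card_union_le (U ∪ L) L'
    have h3 := Finset.card_union_le U L
    omega
  intro i
  induction i with
  | zero =>
    intro _
    obtain ⟨v, hv⟩ := hHne
    obtain ⟨L', rk', d', h1, h2, m, m1, m2, m3⟩ := step 0 ∅ {v} _ _ (by omega) (lev_zero v)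
      (by simp) (by simpa using hv) (by simp)
    have hm : E ≤ E * m := Nat.le_mul_of_pos_right _ m2
    rw [Finset.card_empty, Finset.card_singleton] at m3
    have e1 : r * (q+2) = r * q + 2 * r := by ring
    have hrq : 1 ≤ r * q := Nat.mul_pos hr (by omega)
    refine ⟨_, L', rk', d', h1, ?_, h2, ?_, ?_⟩
    · simpa using hv
    · rw [Finset.empty_union, Finset.card_singleton]; omega
    · rw [zero_add, pow_one]; omega
  | succ i ih =>
    intro hi
    obtain ⟨U, L, rk, d, hl, hU, hL, hUL, hLc⟩ := ih (by omega)
    have hpos : 1 ≤ L.card := by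
      have : 1 ≤ q^(i+1) := Nat.one_le_pow _ _ (by omega)
      nlinarith
    obtain ⟨L', rk', d', h1, h2, m, m1, m2, m3⟩ := step (i+1) U L rk d hi hl hU hL hpos
    have h3 : q * L.card ≤ L'.card := by
      have a1 : r * (q+2) * m ≤ E * m := Nat.mul_le_mul_right _ hEq
      have a2 : r * (q+2) * m = (q+2) * (r * m) := by ring
      have a3 : (q+2) * L.card ≤ (q+2) * (r*m) := Nat.mul_le_mul_left _ m1
      have a4 : (q+2) * L.card = q * L.card + 2 * L.card := by ring
      omega
    have h4 : 2 * L.card ≤ q * L.card := Nat.mul_le_mul_right _ hq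
    refine ⟨_, L', rk', d', h1, Finset.union_subset hU hL, h2, ?_, ?_⟩
    · have := Finset.card_union_le U L
      omega
    · calc r * q^(i+1+1) = q * (r * q^(i+1)) := by ring
        _ ≤ q * L.card := Nat.mul_le_mul_left _ hLc
        _ ≤ L'.card := h3

theorem short_cycle [Fintype V] [DecidableEq V] {H : Finset V} {k r : ℕ} (hk0 : 0 < k)
    (hk : IndepNumLE G k)
    (hE : ∀ I N, I ⊆ H → I.Nonempty → Indep G I → N ⊆ H → I ⊆ N →
      (∀ y ∈ I, ∀ x ∈ H, G.Adj y x → x ∈ N) → 120 * k * I.card ≤ N.card)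
    (hHne : H.Nonempty) (hr : 1 ≤ r) (hrk : r ≤ 6*k) : HasCycleLength G (r+2) := by
  by_contra hno
  obtain ⟨q, hqdef⟩ : ∃ q, q = 120*k/r - 2 := ⟨_, rfl⟩
  have h20 : 20 ≤ 120*k/r := by
    rw [Nat.le_div_iff_mul_le (by omega)]; omega
  have hq18 : 18 ≤ q := by omega
  have hq2 : q + 2 = 120*k/r := by omega
  have hEq : r * (q+2) ≤ 120*k := by rw [hq2]; exact Nat.mul_div_le _ _
  have hlt : 120*k < r * (q+3) := by
    have := Nat.lt_mul_div_succ (120*k) (b := r) (by omega)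
    rw [← hq2] at this
    exact this
  obtain ⟨y, hy⟩ : ∃ y, y + 1 = (r+1)/2 := ⟨(r+1)/2 - 1, by omega⟩
  obtain ⟨U, L, rk, d, hl, -, -, -, hLc⟩ := lev_grow hE hHne hr (by omega) hEq hno y (by omega)
  obtain ⟨I, -, hIi, hIc⟩ := lev_indep hl (by omega) hr hno
  have hIk : I.card ≤ k := hk I hIi
  have h1 : r * q^(y+1) ≤ r * k := hLc.trans (hIc.trans (Nat.mul_le_mul_left _ hIk))
  have h2 : q^(y+1) ≤ k := Nat.le_of_mul_le_mul_left h1 (by omega)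
  have h3 : y < q^y := Nat.lt_pow_self (by omega)
  have h4 : 120 * (q * q^y) < r * (q+3) := by
    have : q^(y+1) = q * q^y := by ring
    omega
  have h5 : r * (q+3) ≤ (2*(y+1)) * (2*q) := Nat.mul_le_mul (by omega) (by omega)
  have h6 : q * (y+1) ≤ q * q^y := Nat.mul_le_mul_left _ h3
  have h7 : (2*(y+1)) * (2*q) = 4 * (q*(y+1)) := by ring
  omega

end Short

theorem main_nat {V : Type} [Fintype V] {G : SimpleGraph V} {k : ℕ} (hk0 : 0 < k)
    (hham : IsHamiltonianGraph G) (hk : IndepNumLE G k) (hn : 200 * k^2 ≤ Fintype.card V) :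
    Pancyclic G := by
  classical
  intro ℓ hℓ3 hℓn
  obtain ⟨v, c, hc, hall⟩ := hham
  obtain ⟨a, b, l, hl, hba, hlen, hmem⟩ := cycle_to_list hc
  have hcard : l.length = Fintype.card V := by
    rw [← List.toFinset_card_of_nodup hl.1]
    have : l.toFinset = Finset.univ := by
      ext x; simp [hmem x (hall x)]
    rw [this, Finset.card_univ]
  have hcyc : HasCycleLength G (Fintype.card V) := ⟨v, c, hc, by omega⟩
  rcases Nat.lt_or_ge (2*k^2 + k) ℓ with h1 | h1
  · exact descend_all hk hk0 (by omega) hℓn hcyc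
  have hk2 : 1 ≤ k^2 := Nat.one_le_pow _ _ hk0
  have hsplit : l.take (124*k^2) ++ l.drop (124*k^2) = l := List.take_append_drop _ _
  have hI : (l.take (124*k^2)).toFinset.card = 124*k^2 := by
    rw [List.toFinset_card_of_nodup (hl.1.sublist (List.take_sublist _ _)), List.length_take]
    omega
  obtain ⟨H, hHX, hHne, hconn, hE⟩ := exists_core hk0 hk (l.take (124*k^2)).toFinset hI.ge
  have hdeg : ∀ a ∈ H, ∀ N : Finset V, a ∈ N → (∀ x ∈ H, G.Adj a x → x ∈ N) →
      120*k ≤ N.card := by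
    intro a ha N haN hN
    have h2 := hE {a} (N ∩ H) (by simpa using ha) (by simp)
      (by intro x hx y hy hxy; simp at hx hy; exact absurd (hx.trans hy.symm) hxy)
      Finset.inter_subset_right (by simp [haN, ha])
      (by
        intro y hy x hx hadj
        simp at hy
        subst hy
        rw [Finset.mem_inter]
        exact ⟨hN x hx hadj, hx⟩)
    rw [Finset.card_singleton, mul_one] at h2
    exact h2.trans (Finset.card_le_card Finset.inter_subset_left)
  rcases Nat.lt_or_ge ℓ (6*k) with h2 | h2
  · have := short_cycle (r := ℓ - 2) hk0 hk hE hHne (by omega) (by omega)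
    have e : ℓ - 2 + 2 = ℓ := by omega
    rw [e] at this
    exact this
  · have hH2 : 2 ≤ H.card := by
      obtain ⟨x, hx⟩ := hHne
      have := hdeg x hx H hx (fun y hy _ => hy)
      omega
    rw [← hsplit] at hl
    refine gap_fill hk0 hk hconn hdeg hH2 hl hba ?_ ?_ h2 (by omega)
    · intro x hx
      exact List.mem_toFinset.1 (hHX hx)
    · rw [List.length_drop]; omega


/-- Erdős's conjecture: there is a constant C such that every Hamiltonian graph on
n ≥ Ck² vertices with independence number at most k is pancyclic. -/
theorem stmt15 :
    ∃ C : ℝ, 0 < C ∧ ∀ k : ℕ, 0 < k →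
      ∀ (V : Type) [Fintype V] (G : SimpleGraph V),
        IsHamiltonianGraph G → IndepNumLE G k →
        C * (k : ℝ) ^ 2 ≤ (Fintype.card V : ℝ) →
        Pancyclic G := by
  refine ⟨200, by norm_num, ?_⟩
  intro k hk0 V _ G hham hk hn
  exact main_nat hk0 hham hk (by exact_mod_cast hn)
end
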